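/- arXiv:1902.06081 — 2 statements merged into one kernel-verified Lean document; each statement's English description precedes it below -/
import Mathlib

section
/- Let (a,b) ∈ ℝ² satisfy ω^×(a,b) < 4, and let ψ : ℕ → ℝ_{≥0} be a decreasing function such that Σ_{n=1}^∞ ψ(n) log n < ∞. Then for Lebesgue-almost every β ∈ ℝ, setting α = aβ + b, there exist at most finitely many n ∈ ℕ for which ⟨nα⟩ ⟨nβ⟩ < ψ(n). -/
/-!
Convergence theory on planar lines, multiplicative-exponent variant
(Chow–Yang, Theorem 1.6): if `ω^×(a,b) < 4` and `ψ` is decreasing with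
`Σ ψ(n) log n < ∞`, then for almost every point `(α,β)` on the line
`α = aβ + b`, the inequality `⟨nα⟩⟨nβ⟩ < ψ(n)` has at most finitely many
solutions `n ∈ ℕ`.
-/

open MeasureTheory

noncomputable section

/-- Distance from a real number to the nearest integer, `⟨x⟩`. -/
def distNearestInt (x : ℝ) : ℝ := |x - round x|

/-- `ω^×(a,b) < 4`, where `ω^×(a,b)` is the multiplicative exponent of `(a,b)`:
the supremum of `w` such that `⟨na⟩⟨nb⟩ ≤ n^{-w}` for infinitely many `n ∈ ℕ`.
Since the set of such `w` is an interval unbounded below, `ω^×(a,b) < 4` is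
equivalent to the existence of `w < 4` for which only finitely many `n`
satisfy the inequality. -/
def MultExpLtFour (a b : ℝ) : Prop :=
  ∃ w : ℝ, w < 4 ∧
    {n : ℕ | 0 < n ∧
      distNearestInt (n * a) * distNearestInt (n * b) ≤ (n : ℝ) ^ (-w)}.Finite

def ee (x : ℝ) : ℂ := Complex.exp (Complex.I * ((2 * Real.pi * x : ℝ) : ℂ))

lemma ee_add (x y : ℝ) : ee (x + y) = ee x * ee y := by
  unfold ee
  rw [← Complex.exp_add]; congr 1; push_cast; ring

lemma ee_norm (x : ℝ) : ‖ee x‖ = 1 := by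
  unfold ee
  rw [mul_comm]; exact Complex.norm_exp_ofReal_mul_I _

lemma ee_conj (x : ℝ) : (starRingEnd ℂ) (ee x) = ee (-x) := by
  unfold ee
  rw [← Complex.exp_conj]; congr 1
  rw [map_mul, Complex.conj_I, Complex.conj_ofReal]; push_cast; ring

lemma ee_int (m : ℤ) : ee m = 1 := by
  unfold ee
  rw [Complex.exp_eq_one_iff]
  exact ⟨m, by push_cast; ring⟩

lemma ee_nat_mul (i : ℕ) (x : ℝ) : ee (i * x) = ee x ^ i := by
  unfold ee
  rw [← Complex.exp_nat_mul]; congr 1; push_cast; ring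

lemma d_nonneg (x : ℝ) : 0 ≤ distNearestInt x := abs_nonneg _
lemma d_le (x : ℝ) : distNearestInt x ≤ 1/2 := abs_sub_round x
lemma d_le_abs (x : ℝ) (m : ℤ) : distNearestInt x ≤ |x - m| := round_le x m

def GG (M : ℕ) (x : ℝ) : ℂ := ∑ i ∈ Finset.range M, ee (i * x)

lemma GG_le (M : ℕ) (x : ℝ) : ‖GG M x‖ ≤ M := by
  unfold GG
  refine (norm_sum_le _ _).trans ?_
  simp [ee_norm]

lemma GG_le' (M : ℕ) (x : ℝ) : ‖GG M x‖ * (2 * distNearestInt x) ≤ 1 := by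
  have h1 : GG M x * (ee x - 1) = ee x ^ M - 1 := by
    unfold GG
    simp_rw [ee_nat_mul]
    exact geom_sum_mul _ _
  have h2 : ‖ee x ^ M - 1‖ ≤ 2 := by
    refine (norm_sub_le _ _).trans ?_
    rw [norm_pow, ee_norm]; norm_num
  have h3 : 4 * distNearestInt x ≤ ‖ee x - 1‖ := by
    have : ee x = ee (x - round x) := by
      have := ee_add (x - round x) (round x)
      rw [ee_int, sub_add_cancel, mul_one] at this
      exact this
    rw [this]
    set y := x - round x with hy
    have hd : distNearestInt x = |y| := rfl
    have hy2 : |y| ≤ 1/2 := abs_sub_round x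
    unfold ee
    rw [Complex.norm_exp_I_mul_ofReal_sub_one, hd]
    have e : 2 * Real.pi * y / 2 = Real.pi * y := by ring
    rw [e, Real.norm_eq_abs, abs_mul, abs_two]
    have hp := Real.pi_pos
    have key : 2 / Real.pi * (Real.pi * |y|) ≤ Real.sin (Real.pi * |y|) :=
      Real.mul_le_sin (by positivity) (by nlinarith)
    have e2 : 2 / Real.pi * (Real.pi * |y|) = 2 * |y| := by field_simp
    rw [e2] at key
    have : |Real.sin (Real.pi * y)| = |Real.sin (Real.pi * |y|)| := by
      rcases abs_cases y with ⟨h, _⟩ | ⟨h, _⟩ <;> rw [h]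
      rw [mul_neg, Real.sin_neg, abs_neg]
    rw [this]
    linarith [le_abs_self (Real.sin (Real.pi * |y|))]
  have h4 : ‖GG M x‖ * ‖ee x - 1‖ ≤ 2 := by rw [← norm_mul, h1]; exact h2
  have := mul_le_mul_of_nonneg_left h3 (norm_nonneg (GG M x))
  linarith

def KK : ℝ := ∑' i : ℤ, 1 / (1 + (i:ℝ)^2)

lemma KK_summable : Summable (fun i : ℤ => 1 / (1 + (i:ℝ)^2)) := by
  have h := Real.summable_one_div_int_pow (p := 2) |>.2 (by norm_num)
  refine Summable.of_norm_bounded_eventually h ?_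
  rw [Filter.eventually_cofinite]
  refine (Set.finite_singleton (0:ℤ)).subset ?_
  intro i hi
  by_contra h0
  apply hi
  have h0' : (i:ℝ) ≠ 0 := by exact_mod_cast h0
  rw [Real.norm_of_nonneg (by positivity)]
  apply one_div_le_one_div_of_le (by positivity)
  linarith

lemma GG_cell (M : ℕ) (hM : 0 < M) (x : ℝ) :
    ‖GG M x‖^2 ≤ 4 * (M:ℝ)^2 * (1 / (1 + ((⌊(x - round x) * M⌋ : ℤ):ℝ)^2)) := by
  have hM' : (0:ℝ) < M := by exact_mod_cast hM
  set y := x - round x with hy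
  have hd : distNearestInt x = |y| := rfl
  have h1 := GG_le M x
  have h2 := GG_le' M x
  rw [hd] at h2
  set g := ‖GG M x‖ with hg
  have hg0 : 0 ≤ g := norm_nonneg _
  set i : ℝ := ((⌊y * M⌋ : ℤ):ℝ) with hi
  have f1 : i ≤ y * M := Int.floor_le _
  have f2 : y * M < i + 1 := Int.lt_floor_add_one _
  have h3 : i^2 ≤ 2 * (y*M)^2 + 2 := by nlinarith [sq_nonneg (y*M + (y * M - i)), sq_nonneg (y*M - i)]
  have h4 : g^2 ≤ M^2 := by nlinarith
  have h5 : g^2 * y^2 ≤ 1/4 := by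
    have : (g * (2 * |y|))^2 ≤ 1 := by
      have : 0 ≤ g * (2 * |y|) := by positivity
      nlinarith
    have e : (g * (2 * |y|))^2 = 4 * (g^2 * |y|^2) := by ring
    rw [e, sq_abs] at this
    linarith
  rw [mul_one_div, le_div_iff₀ (by positivity)]
  calc g^2 * (1 + i^2) ≤ g^2 * (3 + 2 * (y*M)^2) := by
        apply mul_le_mul_of_nonneg_left _ (by positivity); linarith
    _ = 3 * g^2 + 2 * (g^2*y^2) * M^2 := by ring
    _ ≤ 3 * M^2 + 2 * (1/4) * M^2 := by gcongr
    _ ≤ 4 * (M:ℝ)^2 := by nlinarith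

lemma sep_sum (a b : ℝ) (M Z : ℕ) (hM : 0 < M)
    (hsep : ∀ z : ℕ, 0 < z → z < Z →
      1 / (M:ℝ) ≤ distNearestInt (z * a) ∨ 1 / (M:ℝ) ≤ distNearestInt (z * b)) (z' : ℕ) :
    ∑ z ∈ Finset.range Z, ‖GG M (((z:ℝ) - z') * a)‖^2 * ‖GG M (((z:ℝ) - z') * b)‖^2
      ≤ 16 * KK^2 * (M:ℝ)^4 := by
  have hM' : (0:ℝ) < M := by exact_mod_cast hM
  let c : ℝ → ℤ := fun x => ⌊(x - round x) * M⌋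
  let φ : ℕ → ℤ × ℤ := fun z => (c (((z:ℝ) - z') * a), c (((z:ℝ) - z') * b))
  let h : ℤ → ℝ := fun i => 1 / (1 + (i:ℝ)^2)
  have hc : ∀ x y : ℝ, c x = c y → distNearestInt (x - y) < 1 / M := by
    intro x y hxy
    have := Int.abs_sub_lt_one_of_floor_eq_floor hxy
    rw [← sub_mul, abs_mul, abs_of_pos hM'] at this
    rw [lt_div_iff₀ hM']
    refine lt_of_le_of_lt (mul_le_mul_of_nonneg_right (d_le_abs _ (round x - round y)) hM'.le) ?_
    have e : x - y - ((round x - round y : ℤ) : ℝ) = x - round x - (y - round y) := by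
      push_cast; ring
    rw [e]; exact this
  have key : ∀ z1 z2 : ℕ, z1 < z2 → z2 < Z → φ z1 ≠ φ z2 := by
    intro z1 z2 h12 h2 he
    have ha := hc _ _ (congrArg Prod.fst he).symm
    have hb := hc _ _ (congrArg Prod.snd he).symm
    have e1 : ∀ t : ℝ, ((z2:ℝ) - z') * t - ((z1:ℝ) - z') * t = ((z2 - z1 : ℕ) : ℝ) * t := by
      intro t; rw [Nat.cast_sub h12.le]; ring
    rw [e1] at ha hb
    rcases hsep (z2 - z1) (by omega) (by omega) with h | h <;> linarith
  have hinj : Set.InjOn φ (Finset.range Z) := by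
    intro z1 h1 z2 h2 he
    simp only [Finset.coe_range, Set.mem_Iio] at h1 h2
    rcases lt_trichotomy z1 z2 with h | h | h
    · exact absurd he (key _ _ h h2)
    · exact h
    · exact absurd he.symm (key _ _ h h1)
  have hs : Summable (fun p : ℤ × ℤ => h p.1 * h p.2) :=
    KK_summable.mul_of_nonneg KK_summable (fun i => by positivity) (fun i => by positivity)
  have ht : ∑' p : ℤ × ℤ, h p.1 * h p.2 = KK^2 := by
    rw [sq]; unfold KK
    exact (KK_summable.tsum_mul_tsum KK_summable hs).symm
  calc _ ≤ ∑ z ∈ Finset.range Z, 16 * (M:ℝ)^4 * (h (φ z).1 * h (φ z).2) := by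
        apply Finset.sum_le_sum
        intro z _
        have A := GG_cell M hM (((z:ℝ) - z') * a)
        have B := GG_cell M hM (((z:ℝ) - z') * b)
        refine (mul_le_mul A B (by positivity) (by positivity)).trans (le_of_eq ?_)
        simp only [h, φ, c]; ring
    _ = 16 * (M:ℝ)^4 * ∑ p ∈ (Finset.range Z).image φ, h p.1 * h p.2 := by
        rw [Finset.sum_image hinj, Finset.mul_sum]
    _ ≤ 16 * (M:ℝ)^4 * KK^2 := by
        rw [← ht]
        apply mul_le_mul_of_nonneg_left _ (by positivity)
        exact hs.sum_le_tsum _ (fun p _ => by positivity)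
    _ = _ := by ring

lemma autocorr (P : ℕ) (F : ℤ → ℝ) (hF : ∀ p, 0 ≤ F p) :
    (P:ℝ) * ∑ p ∈ Finset.Icc (-(P:ℤ)) P, F p ≤
      ∑ i ∈ Finset.range (2*P), ∑ j ∈ Finset.range (2*P), F ((i:ℤ) - j) := by
  rw [← Finset.sum_product']
  let g : ℤ × ℕ → ℕ × ℕ := fun t => (t.2 + t.1.toNat, t.2 + (-t.1).toNat)
  have hinj : Set.InjOn g (Finset.Icc (-(P:ℤ)) P ×ˢ Finset.range P : Finset _) := by
    rintro ⟨p, s⟩ _ ⟨p', s'⟩ _ h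
    simp only [g, Prod.mk.injEq] at h ⊢
    omega
  calc (P:ℝ) * ∑ p ∈ Finset.Icc (-(P:ℤ)) P, F p
      = ∑ t ∈ Finset.Icc (-(P:ℤ)) P ×ˢ Finset.range P, F t.1 := by
        rw [Finset.sum_product, Finset.mul_sum]; simp
    _ = ∑ t ∈ Finset.Icc (-(P:ℤ)) P ×ˢ Finset.range P, F (((g t).1 : ℤ) - (g t).2) := by
        apply Finset.sum_congr rfl
        rintro ⟨p, s⟩ _
        congr 1
        simp only [g]; push_cast; omega
    _ = ∑ x ∈ (Finset.Icc (-(P:ℤ)) P ×ˢ Finset.range P).image g, F ((x.1:ℤ) - x.2) := by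
        rw [Finset.sum_image hinj]
    _ ≤ _ := by
        apply Finset.sum_le_sum_of_subset_of_nonneg
        · intro x hx
          simp only [Finset.mem_image, Finset.mem_product, Finset.mem_Icc, Finset.mem_range, g] at hx ⊢
          obtain ⟨⟨p, s⟩, h, rfl⟩ := hx
          simp only at h ⊢
          omega
        · intros; exact hF _

lemma sum_rot {X Y W R : Type*} [AddCommMonoid R] (s : Finset X) (t : Finset Y) (u : Finset W)
    (f : X → Y → W → R) :
    ∑ x ∈ s, ∑ y ∈ t, ∑ w ∈ u, f x y w = ∑ w ∈ u, ∑ x ∈ s, ∑ y ∈ t, f x y w := by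
  rw [Finset.sum_comm (s := u)]
  exact Finset.sum_congr rfl fun x _ => Finset.sum_comm

lemma GG_normsq (M : ℕ) (t : ℝ) :
    ((‖GG M t‖^2 : ℝ) : ℂ) = ∑ w ∈ Finset.range M ×ˢ Finset.range M, ee (((w.1:ℝ) - w.2) * t) := by
  have : ((‖GG M t‖^2 : ℝ) : ℂ) = GG M t * (starRingEnd ℂ) (GG M t) := by
    rw [Complex.mul_conj, Complex.normSq_eq_norm_sq]
  rw [this, Finset.sum_product]
  unfold GG
  rw [map_sum, Finset.sum_mul_sum]
  refine Finset.sum_congr rfl fun i _ => Finset.sum_congr rfl fun j _ => ?_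
  rw [ee_conj, ← ee_add]; congr 1; ring

lemma quad_identity (a b : ℝ) (M Z : ℕ) :
    ∑ x ∈ Finset.range M ×ˢ Finset.range M, ∑ y ∈ Finset.range M ×ˢ Finset.range M,
      ‖GG Z (a * ((x.1:ℝ) - x.2) + b * ((y.1:ℝ) - y.2))‖^2
    = ∑ w ∈ Finset.range Z ×ˢ Finset.range Z,
      ‖GG M (((w.1:ℝ) - w.2) * a)‖^2 * ‖GG M (((w.1:ℝ) - w.2) * b)‖^2 := by
  have : ((∑ x ∈ Finset.range M ×ˢ Finset.range M, ∑ y ∈ Finset.range M ×ˢ Finset.range M,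
      ‖GG Z (a * ((x.1:ℝ) - x.2) + b * ((y.1:ℝ) - y.2))‖^2 : ℝ) : ℂ)
    = ((∑ w ∈ Finset.range Z ×ˢ Finset.range Z,
      ‖GG M (((w.1:ℝ) - w.2) * a)‖^2 * ‖GG M (((w.1:ℝ) - w.2) * b)‖^2 : ℝ) : ℂ) := by
    rw [Complex.ofReal_sum, Complex.ofReal_sum]
    simp_rw [Complex.ofReal_mul, Complex.ofReal_sum, GG_normsq, Finset.sum_mul_sum]
    rw [sum_rot]
    refine Finset.sum_congr rfl fun w _ => Finset.sum_congr rfl fun x _ =>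
      Finset.sum_congr rfl fun y _ => ?_
    rw [← ee_add]; congr 1; ring
  exact_mod_cast this

lemma quad_bound (a b : ℝ) (M Z : ℕ) (hM : 0 < M)
    (hsep : ∀ z : ℕ, 0 < z → z < Z →
      1 / (M:ℝ) ≤ distNearestInt (z * a) ∨ 1 / (M:ℝ) ≤ distNearestInt (z * b)) :
    ∑ x ∈ Finset.range M ×ˢ Finset.range M, ∑ y ∈ Finset.range M ×ˢ Finset.range M,
      ‖GG Z (a * ((x.1:ℝ) - x.2) + b * ((y.1:ℝ) - y.2))‖^2
    ≤ Z * (16 * KK^2 * (M:ℝ)^4) := by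
  rw [quad_identity, Finset.sum_product_right]
  refine (Finset.sum_le_sum fun z' _ => sep_sum a b M Z hM hsep z').trans ?_
  simp

lemma pair_bound (a b : ℝ) (P Z : ℕ) (hP : 0 < P)
    (hsep : ∀ z : ℕ, 0 < z → z < Z →
      1 / ((2 * P : ℕ):ℝ) ≤ distNearestInt (z * a) ∨ 1 / ((2 * P : ℕ):ℝ) ≤ distNearestInt (z * b)) :
    ∑ p ∈ Finset.Icc (-(P:ℤ)) P, ∑ n ∈ Finset.Icc (-(P:ℤ)) P,
      ‖GG Z (a * p + b * n)‖^2 ≤ 256 * KK^2 * P^2 * Z := by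
  have hP' : (0:ℝ) < P := by exact_mod_cast hP
  have h := quad_bound a b (2*P) Z (by omega) hsep
  have h1 := autocorr P (fun p => ∑ n ∈ Finset.Icc (-(P:ℤ)) P, ‖GG Z (a * p + b * n)‖^2)
    (fun p => by positivity)
  have h2 : ∀ p : ℤ, _ := fun p : ℤ =>
    autocorr P (fun n => ‖GG Z (a * p + b * n)‖^2) (fun p => by positivity)
  have h3 : (P:ℝ) * ((P:ℝ) * ∑ p ∈ Finset.Icc (-(P:ℤ)) P, ∑ n ∈ Finset.Icc (-(P:ℤ)) P,
      ‖GG Z (a * p + b * n)‖^2) ≤ Z * (16 * KK^2 * ((2*P : ℕ):ℝ)^4) := by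
    refine le_trans ?_ h
    refine (mul_le_mul_of_nonneg_left h1 hP'.le).trans ?_
    rw [Finset.sum_product, Finset.mul_sum]
    refine Finset.sum_le_sum fun i _ => ?_
    rw [Finset.mul_sum]
    refine Finset.sum_le_sum fun j _ => ?_
    refine (h2 _).trans (le_of_eq ?_)
    rw [Finset.sum_product]
    push_cast
    rfl
  have h4 : (P:ℝ)^2 * (∑ p ∈ Finset.Icc (-(P:ℤ)) P, ∑ n ∈ Finset.Icc (-(P:ℤ)) P,
      ‖GG Z (a * p + b * n)‖^2) ≤ (P:ℝ)^2 * (256 * KK^2 * P^2 * Z) := by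
    refine le_trans (le_of_eq (by ring)) (h3.trans (le_of_eq ?_))
    push_cast; ring
  exact le_of_mul_le_mul_left h4 (by positivity)

lemma GG_lower (Z : ℕ) (hZ : 0 < Z) (x : ℝ) (hx : distNearestInt x ≤ 1 / (8 * Z)) :
    (Z:ℝ) / 4 ≤ ‖GG Z x‖^2 / Z := by
  have hZ' : (0:ℝ) < Z := by exact_mod_cast hZ
  have : (Z:ℝ)/2 ≤ (GG Z x).re := by
    unfold GG
    rw [Complex.re_sum]
    have : (Z:ℝ)/2 = ∑ i ∈ Finset.range Z, (1/2:ℝ) := by simp; ring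
    rw [this]
    refine Finset.sum_le_sum fun i hi => ?_
    have hi' : (i:ℝ) ≤ Z := by exact_mod_cast (Finset.mem_range.1 hi).le
    set y := x - round x with hy
    have e : ee (i * x) = ee (i * y) := by
      have h1 : (i:ℝ) * x = i * y + ((i * round x : ℤ) : ℝ) := by rw [hy]; push_cast; ring
      rw [h1, ee_add, ee_int, mul_one]
    have hy1 : |y| ≤ 1 / (8 * Z) := hx
    have hy2 : |(i:ℝ) * y| ≤ 1/8 := by
      rw [abs_mul, Nat.abs_cast]
      calc (i:ℝ) * |y| ≤ Z * (1 / (8 * Z)) := by gcongr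
        _ = 1/8 := by field_simp
    rw [e]
    have e3 : (ee (i * y)).re = Real.cos (2 * Real.pi * (i * y)) := by
      unfold ee
      rw [mul_comm, Complex.exp_ofReal_mul_I_re]
    rw [e3]
    have h5 : (2 * Real.pi * (i * y))^2 ≤ 1 := by
      rw [sq_le_one_iff_abs_le_one, abs_mul, abs_of_pos (by positivity)]
      nlinarith [Real.pi_lt_four, Real.pi_pos, abs_nonneg ((i:ℝ) * y)]
    have := Real.one_sub_sq_div_two_le_cos (x := 2 * Real.pi * (i * y))
    linarith
  have h2 : (Z:ℝ)/2 ≤ ‖GG Z x‖ := this.trans (Complex.re_le_norm _)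
  rw [le_div_iff₀ hZ']
  nlinarith

def ind (y : ℝ) (z : ℕ) : ℝ := if y ≤ 1 / (8 * (z:ℝ)) then 1 else 0
def cnt (Z : ℕ) (y : ℝ) : ℝ := ∑ z ∈ Finset.Icc 1 Z, ind y z

lemma ind_nonneg (y : ℝ) (z : ℕ) : 0 ≤ ind y z := by unfold ind; split_ifs <;> norm_num
lemma cnt_nonneg (y : ℝ) (Z : ℕ) : 0 ≤ cnt Z y := Finset.sum_nonneg fun _ _ => ind_nonneg _ _

lemma cnt_alt (y : ℝ) (hy : 0 ≤ y) (Z : ℕ) :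
    (Z:ℝ) ≤ cnt Z y ∨ (0 < y ∧ 1 / y ≤ 8 * (1 + cnt Z y)) := by
  by_cases h : y * (8 * Z) ≤ 1
  · left
    unfold cnt
    have : (Z:ℝ) = ∑ z ∈ Finset.Icc 1 Z, (1:ℝ) := by simp
    rw [this]
    refine Finset.sum_le_sum fun z hz => ?_
    obtain ⟨h1, h2⟩ := Finset.mem_Icc.1 hz
    have h1' : (1:ℝ) ≤ z := by exact_mod_cast h1
    have h2' : (z:ℝ) ≤ Z := by exact_mod_cast h2
    unfold ind
    rw [if_pos]
    rw [le_div_iff₀ (by positivity)]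
    nlinarith
  · right
    push Not at h
    have hy0 : 0 < y := by
      rcases hy.eq_or_lt with h0 | h0
      · rw [← h0] at h; linarith
      · exact h0
    refine ⟨hy0, ?_⟩
    set m := ⌊1 / (8 * y)⌋₊ with hm
    have hm1 : (m:ℝ) ≤ 1 / (8*y) := Nat.floor_le (by positivity)
    have hm2 : 1 / (8*y) < m + 1 := Nat.lt_floor_add_one _
    have hmZ : m ≤ Z := by
      have : (m:ℝ) < Z := by
        refine lt_of_le_of_lt hm1 ?_
        rw [div_lt_iff₀ (by positivity)]; linarith
      exact_mod_cast this.le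
    have hc : (m:ℝ) ≤ cnt Z y := by
      have e : (m:ℝ) = ∑ z ∈ Finset.Icc 1 m, (1:ℝ) := by simp
      rw [e]
      unfold cnt
      refine le_trans (Finset.sum_le_sum fun z hz => ?_)
        (Finset.sum_le_sum_of_subset_of_nonneg (Finset.Icc_subset_Icc_right hmZ)
          fun z _ _ => ind_nonneg y z)
      obtain ⟨h1, h2⟩ := Finset.mem_Icc.1 hz
      have h1' : (1:ℝ) ≤ z := by exact_mod_cast h1
      have h2' : (z:ℝ) ≤ m := by exact_mod_cast h2
      unfold ind
      rw [if_pos]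
      have := h2'.trans hm1
      rw [le_div_iff₀ (by positivity)] at this ⊢
      linarith
    have e : 1 / y = 8 * (1 / (8*y)) := by field_simp
    rw [e]; linarith

lemma count_bound (a b : ℝ) (P Z : ℕ) (hP : 0 < P)
    (hsep : ∀ z : ℕ, 0 < z → z < Z →
      1 / ((2 * P : ℕ):ℝ) ≤ distNearestInt (z * a) ∨ 1 / ((2 * P : ℕ):ℝ) ≤ distNearestInt (z * b)) :
    ∑ p ∈ Finset.Icc (-(P:ℤ)) P, ∑ n ∈ Finset.Icc (-(P:ℤ)) P,
      (1 + cnt Z (distNearestInt (a * p + b * n))) ≤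
      (9 + 1024 * KK^2) * P^2 * (1 + (1 + Real.log Z)) := by
  have hP' : (1:ℝ) ≤ P := by exact_mod_cast hP
  have h1 : ∀ z ∈ Finset.Icc 1 Z, ∑ p ∈ Finset.Icc (-(P:ℤ)) P, ∑ n ∈ Finset.Icc (-(P:ℤ)) P,
      ind (distNearestInt (a * p + b * n)) z ≤ 1024 * KK^2 * P^2 * (z:ℝ)⁻¹ := by
    intro z hz
    obtain ⟨hz1, hz2⟩ := Finset.mem_Icc.1 hz
    have hz' : (0:ℝ) < z := by exact_mod_cast hz1
    have h := pair_bound a b P z hP (fun u hu huz => hsep u hu (by omega))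
    have h3 : ∑ p ∈ Finset.Icc (-(P:ℤ)) P, ∑ n ∈ Finset.Icc (-(P:ℤ)) P,
      ind (distNearestInt (a * p + b * n)) z ≤ ∑ p ∈ Finset.Icc (-(P:ℤ)) P,
        ∑ n ∈ Finset.Icc (-(P:ℤ)) P, (4 / (z:ℝ)^2) * ‖GG z (a * p + b * n)‖^2 := by
      refine Finset.sum_le_sum fun p _ => Finset.sum_le_sum fun n _ => ?_
      unfold ind
      split_ifs with hh
      · have := GG_lower z hz1 _ hh
        rw [le_div_iff₀ hz'] at this
        rw [div_mul_eq_mul_div, le_div_iff₀ (by positivity)]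
        linarith
      · positivity
    refine h3.trans ?_
    simp_rw [← Finset.mul_sum]
    refine (mul_le_mul_of_nonneg_left h (by positivity)).trans (le_of_eq ?_)
    field_simp
    ring
  have h2 : ∑ z ∈ Finset.Icc 1 Z, (z:ℝ)⁻¹ ≤ 1 + Real.log Z := by
    have := harmonic_le_one_add_log Z
    rw [harmonic_eq_sum_Icc] at this
    push_cast at this
    exact this
  have hlog : 0 ≤ Real.log Z := Real.log_natCast_nonneg Z
  have h3 : ∑ p ∈ Finset.Icc (-(P:ℤ)) P, ∑ n ∈ Finset.Icc (-(P:ℤ)) P,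
      cnt Z (distNearestInt (a * p + b * n)) ≤ 1024 * KK^2 * P^2 * (1 + Real.log Z) := by
    unfold cnt
    have e : ∑ p ∈ Finset.Icc (-(P:ℤ)) P, ∑ n ∈ Finset.Icc (-(P:ℤ)) P,
      ∑ z ∈ Finset.Icc 1 Z, ind (distNearestInt (a * p + b * n)) z =
      ∑ z ∈ Finset.Icc 1 Z, ∑ p ∈ Finset.Icc (-(P:ℤ)) P, ∑ n ∈ Finset.Icc (-(P:ℤ)) P,
        ind (distNearestInt (a * p + b * n)) z := by
      rw [sum_rot]
    rw [e]
    refine (Finset.sum_le_sum h1).trans ?_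
    rw [← Finset.mul_sum]
    exact mul_le_mul_of_nonneg_left h2 (by positivity)
  simp_rw [Finset.sum_add_distrib]
  have h4 : ∑ p ∈ Finset.Icc (-(P:ℤ)) P, ∑ n ∈ Finset.Icc (-(P:ℤ)) P, (1:ℝ) ≤ 9 * P^2 := by
    have : ((P:ℤ) + 1 - -(P:ℤ)).toNat = 2 * P + 1 := by omega
    simp only [Finset.sum_const, Int.card_Icc, this, nsmul_eq_mul]
    push_cast
    nlinarith
  have h5 : 0 ≤ 1024 * KK^2 * (P:ℝ)^2 := by positivity
  nlinarith [mul_nonneg (sq_nonneg (P:ℝ)) hlog]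

lemma vol_interval (n c r : ℝ) (hn : 0 < n) :
    volume {β : ℝ | |n * β - c| < r} ≤ ENNReal.ofReal (2 * r / n) := by
  have : {β : ℝ | |n * β - c| < r} ⊆ Set.Ioo ((c - r)/n) ((c+r)/n) := by
    intro β hβ
    simp only [Set.mem_ofPred_eq, abs_lt] at hβ
    constructor
    · rw [div_lt_iff₀ hn]; linarith
    · rw [lt_div_iff₀ hn]; linarith
  refine (measure_mono this).trans ?_
  rw [Real.volume_Ioo]
  apply le_of_eq; congr 1; ring

lemma vol_E (a b n p q s T : ℝ) (ha : a ≠ 0) (hn : 0 < n) (hs : 0 < s) (hT : 0 < T)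
    (h : 1 ≤ Real.sqrt s * T ∨ 1 / T ≤ |a * p + b * n - q|) :
    volume {β : ℝ | |n * (a * β + b) - q| * |n * β - p| < s} ≤
      ENNReal.ofReal (4 * (2 + 1 / |a|) * (s * T) / n) := by
  set θ := a * p + b * n - q with hθ
  have ha' : 0 < |a| := abs_pos.2 ha
  set r := (2 + 1 / |a|) * (s * T) with hr
  have hr0 : 0 < r := by positivity
  have hsub : {β : ℝ | |n * (a * β + b) - q| * |n * β - p| < s} ⊆
      {β : ℝ | |n * β - p| < r} ∪ {β : ℝ | |n * β - (p - θ / a)| < r} := by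
    intro β hβ
    simp only [Set.mem_ofPred_eq, Set.mem_union] at hβ ⊢
    set t := n * β - p with ht
    have e1 : n * (a * β + b) - q = a * t + θ := by rw [ht, hθ]; ring
    have e2 : n * β - (p - θ / a) = (a * t + θ) / a := by rw [ht]; field_simp; ring
    rw [e1] at hβ
    rw [e2, abs_div, div_lt_iff₀ ha']
    by_contra hcon
    push Not at hcon
    obtain ⟨c1, c2⟩ := hcon
    have hra : r * |a| = (2 * |a| + 1) * (s * T) := by rw [hr]; field_simp
    have hr2 : 2 * (s * T) ≤ r := by
      rw [hr]
      apply mul_le_mul_of_nonneg_right _ (by positivity)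
      have : 0 < 1 / |a| := by positivity
      linarith
    have hsT : 0 < s * T := by positivity
    rcases h with h | h
    · set u := Real.sqrt s with hu
      have hu0 : 0 < u := Real.sqrt_pos.2 hs
      have hus : u * u = s := Real.mul_self_sqrt hs.le
      have hle : u ≤ s * T := by rw [← hus]; nlinarith
      have d1 : u ≤ |t| := by linarith
      have d2 : u ≤ |a * t + θ| := by nlinarith
      nlinarith [mul_le_mul d2 d1 hu0.le (abs_nonneg _)]
    · have hθ0 : 1 ≤ |θ| * T := by
        rw [div_le_iff₀ hT] at h; exact h
      by_cases hc : |a| * |t| ≤ |θ| / 2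
      · have d2 : |θ| / 2 ≤ |a * t + θ| := by
          have := abs_sub_abs_le_abs_sub θ (-(a * t))
          rw [abs_neg, abs_mul, sub_neg_eq_add, add_comm θ] at this
          linarith
        have : (|θ|/2) * (2 * (s * T)) ≤ |a * t + θ| * |t| :=
          mul_le_mul d2 (by linarith) (by positivity) (abs_nonneg _)
        nlinarith
      · push Not at hc
        have d2 : 2 * |a| * (s * T) ≤ |a * t + θ| := by nlinarith
        have : 2 * |a| * (s * T) * |t| ≤ |a * t + θ| * |t| :=
          mul_le_mul_of_nonneg_right d2 (abs_nonneg _)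
        nlinarith
  refine (measure_mono hsub).trans ((measure_union_le _ _).trans ?_)
  refine (add_le_add (vol_interval n _ r hn) (vol_interval n _ r hn)).trans ?_
  rw [← ENNReal.ofReal_add (by positivity) (by positivity)]
  apply le_of_eq; congr 1; rw [hr]; ring

def BB (a b s : ℝ) (L k : ℕ) : Set ℝ :=
  {β : ℝ | |β| ≤ L ∧ ∃ n : ℕ, 2^k ≤ n ∧ n < 2^(k+1) ∧
    distNearestInt (n * (a * β + b)) * distNearestInt (n * β) < s}

lemma vol_BB (a b s : ℝ) (ha : a ≠ 0) (L k Z : ℕ) (hL : 0 < L) (hs : 0 < s)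
    (hZ : 1 ≤ Real.sqrt s * Z)
    (hsep : ∀ z : ℕ, 0 < z → z < Z →
      1 / ((2 * (4 * L * 2^k) : ℕ):ℝ) ≤ distNearestInt (z * a) ∨
      1 / ((2 * (4 * L * 2^k) : ℕ):ℝ) ≤ distNearestInt (z * b)) :
    volume (BB a b s L k) ≤ ENNReal.ofReal
      ((2 * (⌈|a|⌉₊ + 1) + 1) * (4 * (2 + 1 / |a|) * 8) * ((9 + 1024 * KK^2) * (16 * L^2))
        * (2^k * s * (2 + Real.log Z))) := by
  set P : ℕ := 4 * L * 2^k with hP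
  have hP0 : 0 < P := by positivity
  set J : ℕ := ⌈|a|⌉₊ + 1 with hJ
  have ha' : 0 < |a| := abs_pos.2 ha
  set IP := Finset.Icc (-(P:ℤ)) P with hIP
  set NN := Finset.Ico ((2:ℤ)^k) (2^(k+1)) with hNN
  set IJ := Finset.Icc (-(J:ℤ)) J with hIJ
  let E : ℤ → ℤ → ℤ → Set ℝ := fun p n j =>
    {β : ℝ | |(n:ℝ) * (a * β + b) - ((round (a * p + b * n) + j : ℤ) : ℝ)| * |n * β - p| < s}
  have hsub : BB a b s L k ⊆ ⋃ p ∈ IP, ⋃ n ∈ NN, ⋃ j ∈ IJ, E p n j := by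
    rintro β ⟨hβL, n, hn1, hn2, hβ⟩
    simp only [Set.mem_iUnion]
    set p := round ((n:ℝ) * β) with hp
    set q := round ((n:ℝ) * (a * β + b)) with hq
    have hp1 : |(n:ℝ) * β - p| ≤ 1/2 := abs_sub_round _
    have hq1 : |(n:ℝ) * (a * β + b) - q| ≤ 1/2 := abs_sub_round _
    have hx1 : |a * p + b * n - round (a * p + b * (n:ℝ))| ≤ 1/2 := abs_sub_round _
    have hn2' : (n:ℝ) < 2^(k+1) := by exact_mod_cast hn2
    have hk1 : (1:ℝ) ≤ 2^k := one_le_pow₀ (by norm_num)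
    have hL1 : (1:ℝ) ≤ L := by exact_mod_cast hL
    have hpP : |(p:ℝ)| ≤ P := by
      have h1 : |(p:ℝ)| ≤ |(n:ℝ) * β| + 1/2 := by
        have := abs_sub_abs_le_abs_sub (p:ℝ) ((n:ℝ) * β)
        rw [abs_sub_comm] at this
        linarith
      have h2 : |(n:ℝ) * β| ≤ 2^(k+1) * L := by
        rw [abs_mul, Nat.abs_cast]
        exact mul_le_mul hn2'.le hβL (abs_nonneg _) (by positivity)
      rw [hP]; push_cast
      rw [pow_succ] at h2
      nlinarith
    have hpP' : |p| ≤ (P:ℤ) := by exact_mod_cast hpP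
    refine ⟨p, Finset.mem_Icc.2 (abs_le.1 hpP'), (n:ℤ), Finset.mem_Ico.2
      ⟨by exact_mod_cast hn1, by exact_mod_cast hn2⟩, q - round (a * p + b * (n:ℝ)), ?_, ?_⟩
    · have : |((q - round (a * p + b * (n:ℝ)) : ℤ) : ℝ)| ≤ (J:ℝ) := by
        have e : ((q - round (a * p + b * (n:ℝ)) : ℤ) : ℝ) =
          -((n:ℝ) * (a * β + b) - q) + a * ((n:ℝ) * β - p) +
            (a * p + b * n - round (a * p + b * (n:ℝ))) := by push_cast; ring
        rw [e]
        refine (abs_add_three _ _ _).trans ?_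
        rw [abs_neg, abs_mul]
        have hc : |a| ≤ ⌈|a|⌉₊ := Nat.le_ceil _
        rw [hJ]; push_cast
        nlinarith
      have this' : |q - round (a * p + b * (n:ℝ))| ≤ (J:ℤ) := by exact_mod_cast this
      exact Finset.mem_Icc.2 (abs_le.1 this')
    · simp only [E, Set.mem_ofPred_eq]
      have e : round (a * p + b * (((n:ℤ)):ℝ)) + (q - round (a * p + b * (n:ℝ))) = q := by
        push_cast; ring
      rw [e]
      exact hβ
  have hE : ∀ p ∈ IP, ∀ n ∈ NN, ∀ j ∈ IJ, volume (E p n j) ≤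
      ENNReal.ofReal (4 * (2 + 1 / |a|) * 8 * (s / 2^k) *
        (1 + cnt Z (distNearestInt (a * p + b * n)))) := by
    intro p _ n hn j _
    obtain ⟨hn1, hn2⟩ := Finset.mem_Ico.1 hn
    have hn1' : (2:ℝ)^k ≤ n := by exact_mod_cast hn1
    have hk1 : (0:ℝ) < 2^k := by positivity
    have hn0 : (0:ℝ) < n := by linarith
    have hc0 := cnt_nonneg (distNearestInt (a * p + b * n)) Z
    set T := 8 * (1 + cnt Z (distNearestInt (a * p + b * n))) with hT
    have hT0 : 0 < T := by positivity
    refine (vol_E a b n p _ s T ha hn0 hs hT0 ?_).trans ?_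
    · rcases cnt_alt _ (d_nonneg (a * p + b * n)) Z with h | ⟨h0, h⟩
      · left
        refine hZ.trans (mul_le_mul_of_nonneg_left ?_ (Real.sqrt_nonneg _))
        rw [hT]; linarith
      · right
        refine le_trans ?_ (d_le_abs (a * p + b * n) _)
        rw [div_le_iff₀ h0] at h
        rw [div_le_iff₀ hT0, mul_comm]
        exact h
    · apply ENNReal.ofReal_le_ofReal
      calc 4 * (2 + 1 / |a|) * (s * T) / n ≤ 4 * (2 + 1 / |a|) * (s * T) / 2^k := by gcongr
        _ = _ := by rw [hT]; ring
  have hNP : NN ⊆ IP := by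
    intro n hn
    obtain ⟨hn1, hn2⟩ := Finset.mem_Ico.1 hn
    have hk1 : (0:ℤ) < 2^k := by positivity
    have hL1 : (1:ℤ) ≤ L := by exact_mod_cast hL
    rw [hIP, Finset.mem_Icc, hP]
    push_cast
    rw [pow_succ] at hn2
    constructor <;> nlinarith
  set D := 4 * (2 + 1 / |a|) * 8 * (s / 2^k) with hD
  have hD0 : 0 ≤ D := by positivity
  have hcard : (IJ.card : ℝ) = 2 * J + 1 := by
    rw [hIJ, Int.card_Icc]
    have : ((J:ℤ) + 1 - -(J:ℤ)).toNat = 2 * J + 1 := by omega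
    rw [this]; push_cast; ring
  calc volume (BB a b s L k) ≤ volume (⋃ p ∈ IP, ⋃ n ∈ NN, ⋃ j ∈ IJ, E p n j) := measure_mono hsub
    _ ≤ ∑ p ∈ IP, ∑ n ∈ NN, ∑ j ∈ IJ, volume (E p n j) := by
        refine (measure_biUnion_finset_le _ _).trans (Finset.sum_le_sum fun p _ => ?_)
        refine (measure_biUnion_finset_le _ _).trans (Finset.sum_le_sum fun n _ => ?_)
        exact measure_biUnion_finset_le _ _
    _ ≤ ∑ p ∈ IP, ∑ n ∈ NN, ∑ j ∈ IJ,
          ENNReal.ofReal (D * (1 + cnt Z (distNearestInt (a * p + b * n)))) :=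
        Finset.sum_le_sum fun p hp => Finset.sum_le_sum fun n hn => Finset.sum_le_sum fun j hj =>
          hE p hp n hn j hj
    _ ≤ ∑ p ∈ IP, ∑ n ∈ IP, ∑ j ∈ IJ,
          ENNReal.ofReal (D * (1 + cnt Z (distNearestInt (a * p + b * n)))) :=
        Finset.sum_le_sum fun p hp => Finset.sum_le_sum_of_subset hNP
    _ = ENNReal.ofReal (∑ p ∈ IP, ∑ n ∈ IP, ∑ j ∈ IJ,
          D * (1 + cnt Z (distNearestInt (a * p + b * n)))) := by
        have hpos : ∀ p n : ℤ, 0 ≤ D * (1 + cnt Z (distNearestInt (a * p + b * n))) := fun p n =>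
          mul_nonneg hD0 (by linarith [cnt_nonneg (distNearestInt (a * p + b * n)) Z])
        rw [ENNReal.ofReal_sum_of_nonneg fun p _ => Finset.sum_nonneg fun n _ =>
          Finset.sum_nonneg fun j _ => hpos p n]
        refine Finset.sum_congr rfl fun p _ => ?_
        rw [ENNReal.ofReal_sum_of_nonneg fun n _ => Finset.sum_nonneg fun j _ => hpos p n]
        refine Finset.sum_congr rfl fun n _ => ?_
        rw [ENNReal.ofReal_sum_of_nonneg fun j _ => hpos p n]
    _ ≤ _ := by
        apply ENNReal.ofReal_le_ofReal
        simp only [Finset.sum_const, nsmul_eq_mul, hcard]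
        simp_rw [← Finset.mul_sum]
        have hcb := count_bound a b P Z hP0 hsep
        calc (2 * (J:ℝ) + 1) * (D * ∑ p ∈ IP, ∑ n ∈ IP, (1 + cnt Z (distNearestInt (a * p + b * n))))
            ≤ (2 * (J:ℝ) + 1) * (D * ((9 + 1024 * KK^2) * P^2 * (1 + (1 + Real.log Z)))) := by
              gcongr
          _ = _ := by
              rw [hD, hP, hJ]; push_cast
              field_simp
              ring

lemma exp_lower (a b : ℝ) (hab : MultExpLtFour a b) :
    ∃ w : ℝ, 2 ≤ w ∧ w < 4 ∧ ∃ c : ℝ, 0 < c ∧ ∀ z : ℕ, 0 < z →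
      c ≤ distNearestInt (z * a) * distNearestInt (z * b) * (z:ℝ)^w := by
  obtain ⟨w0, hw0, hfin⟩ := hab
  have hmul : ∀ (m z : ℕ) (x : ℝ), distNearestInt (z * x) = 0 →
      distNearestInt ((m * z : ℕ) * x) = 0 := by
    intro m z x h
    have h1 : (z:ℝ) * x - round ((z:ℝ) * x) = 0 := abs_eq_zero.1 h
    refine le_antisymm ?_ (d_nonneg _)
    refine (d_le_abs _ (m * round ((z:ℝ) * x))).trans (le_of_eq ?_)
    rw [abs_eq_zero]
    push_cast
    linear_combination (m:ℝ) * h1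
  have hpos : ∀ z : ℕ, 0 < z → 0 < distNearestInt (z * a) * distNearestInt (z * b) := by
    intro z hz
    refine lt_of_le_of_ne (mul_nonneg (d_nonneg _) (d_nonneg _)) fun h => ?_
    refine Set.infinite_of_injective_forall_mem (f := fun m : ℕ => (m+1) * z) ?_ ?_ hfin
    · intro m1 m2 h
      have := Nat.eq_of_mul_eq_mul_right hz h
      omega
    · intro m
      refine ⟨by positivity, ?_⟩
      have : distNearestInt (((m+1) * z : ℕ) * a) * distNearestInt (((m+1) * z : ℕ) * b) = 0 := by
        rcases mul_eq_zero.1 h.symm with h | h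
        · rw [hmul _ _ _ h, zero_mul]
        · rw [hmul _ _ _ h, mul_zero]
      rw [this]
      positivity
  refine ⟨max w0 2, le_max_right _ _, max_lt hw0 (by norm_num), ?_⟩
  set w := max w0 2 with hw
  set F := {n : ℕ | 0 < n ∧
      distNearestInt (n * a) * distNearestInt (n * b) ≤ (n : ℝ) ^ (-w0)} with hF
  have hFc : ∃ c : ℝ, 0 < c ∧ ∀ z ∈ F,
      c ≤ distNearestInt (z * a) * distNearestInt (z * b) * (z:ℝ)^w := by
    rcases F.eq_empty_or_nonempty with he | hne
    · exact ⟨1, one_pos, by simp [he]⟩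
    · obtain ⟨z0, hz0, hmin⟩ := Set.exists_min_image F
        (fun z : ℕ => distNearestInt (z * a) * distNearestInt (z * b) * (z:ℝ)^w) hfin hne
      have h0 : (0:ℝ) < z0 := by exact_mod_cast hz0.1
      exact ⟨_, mul_pos (hpos z0 hz0.1) (Real.rpow_pos_of_pos h0 w), hmin⟩
  obtain ⟨c, hc, hcF⟩ := hFc
  refine ⟨min c 1, lt_min hc one_pos, fun z hz => ?_⟩
  by_cases hzF : z ∈ F
  · exact (min_le_left _ _).trans (hcF z hzF)
  · refine (min_le_right _ _).trans ?_
    have hz1 : (1:ℝ) ≤ z := by exact_mod_cast hz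
    have hz0 : (0:ℝ) < z := by linarith
    have h1 : (z:ℝ)^(-w0) < distNearestInt (z * a) * distNearestInt (z * b) := by
      by_contra h
      exact hzF ⟨hz, not_lt.1 h⟩
    have h2 : (z:ℝ)^(-w) ≤ (z:ℝ)^(-w0) :=
      Real.rpow_le_rpow_of_exponent_le hz1 (neg_le_neg (le_max_left _ _))
    have h3 : (z:ℝ)^(-w) * (z:ℝ)^w = 1 := by
      rw [← Real.rpow_add hz0]; simp
    rw [← h3]
    exact mul_le_mul_of_nonneg_right (h2.trans h1.le) (by positivity)

lemma exists_tau (w : ℝ) (h2 : 2 ≤ w) (h4 : w < 4) :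
    ∃ τ : ℝ, 1 ≤ τ ∧ τ ≤ 2 ∧ 2 < τ^2 ∧ τ^w < 4 := by
  have hw : 0 < w := by linarith
  have e1 : 1/2 < 2/w := by rw [div_lt_div_iff₀ (by norm_num) hw]; linarith
  have e2 : 2/w ≤ 1 := by rw [div_le_one hw]; exact h2
  set u := (1/2 + 2/w)/2 with hu
  refine ⟨2^u, Real.one_le_rpow (by norm_num) (by linarith), ?_, ?_, ?_⟩
  · calc (2:ℝ)^u ≤ 2^(1:ℝ) := Real.rpow_le_rpow_of_exponent_le (by norm_num) (by linarith)
      _ = 2 := by simp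
  · rw [← Real.rpow_natCast, ← Real.rpow_mul (by norm_num)]
    calc (2:ℝ) = 2^(1:ℝ) := by simp
      _ < _ := Real.rpow_lt_rpow_of_exponent_lt (by norm_num) (by push_cast; linarith)
  · rw [← Real.rpow_mul (by norm_num)]
    have : u * w < 2 := by
      have : u < 2/w := by linarith
      rwa [lt_div_iff₀ hw] at this
    calc (2:ℝ)^(u*w) < 2^(2:ℝ) := Real.rpow_lt_rpow_of_exponent_lt (by norm_num) this
      _ = 4 := by norm_num

lemma cond_summable (ψ : ℕ → ℝ) (hψ0 : ∀ n, 0 ≤ ψ n) (hψmono : Antitone ψ)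
    (hψsum : Summable fun n : ℕ => ψ n * Real.log n) :
    Summable fun k : ℕ => 2^k * ψ (2^k) * (2 + k) := by
  have hg0 : ∀ n : ℕ, 0 ≤ ψ n * Real.log n := fun n =>
    mul_nonneg (hψ0 n) (Real.log_natCast_nonneg n)
  have hl2 : 0 < Real.log 2 := Real.log_pos (by norm_num)
  have h1 : Summable fun k : ℕ => 2^k * (ψ (2^(k+1)) * (k * Real.log 2)) := by
    refine summable_of_sum_range_le (c := ∑' n : ℕ, ψ n * Real.log n) (fun k => ?_) fun K => ?_
    · have := hψ0 (2^(k+1)); positivity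
    · refine le_trans ?_ (hψsum.sum_le_tsum (Finset.range (2^K)) fun n _ => hg0 n)
      induction K with
      | zero => simp
      | succ K ih =>
        rw [Finset.sum_range_succ]
        have hle : 2^K ≤ 2^(K+1) := Nat.pow_le_pow_right (by norm_num) (by omega)
        rw [← Finset.sum_range_add_sum_Ico _ hle]
        refine add_le_add ih ?_
        have hcard : (Finset.Ico (2^K) (2^(K+1))).card = 2^K := by
          rw [Nat.card_Ico, pow_succ]; omega
        have : (2:ℝ)^K * (ψ (2^(K+1)) * (K * Real.log 2)) =
            ∑ n ∈ Finset.Ico (2^K) (2^(K+1)), ψ (2^(K+1)) * (K * Real.log 2) := by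
          rw [Finset.sum_const, hcard, nsmul_eq_mul]; push_cast; ring
        rw [this]
        refine Finset.sum_le_sum fun n hn => ?_
        obtain ⟨hn1, hn2⟩ := Finset.mem_Ico.1 hn
        refine mul_le_mul (hψmono hn2.le) ?_ (by positivity) (hψ0 n)
        rw [← Real.log_pow]
        apply Real.log_le_log (by positivity)
        exact_mod_cast hn1
  have h2 : Summable fun k : ℕ => 2^(k+1) * ψ (2^(k+1)) * (2 + ((k+1:ℕ):ℝ)) := by
    refine Summable.of_norm_bounded_eventually_nat (h1.mul_left (8 / Real.log 2)) ?_
    filter_upwards [Filter.eventually_ge_atTop 1] with k hk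
    have hk' : (1:ℝ) ≤ k := by exact_mod_cast hk
    have hp := hψ0 (2^(k+1))
    rw [Real.norm_of_nonneg (by positivity)]
    have e : 8 / Real.log 2 * (2^k * (ψ (2^(k+1)) * (k * Real.log 2))) =
      2^(k+1) * ψ (2^(k+1)) * (4 * k) := by field_simp; ring
    rw [e]
    apply mul_le_mul_of_nonneg_left _ (by positivity)
    push_cast; linarith
  exact (summable_nat_add_iff 1).1 h2

lemma main_L (a b : ℝ) (hab : MultExpLtFour a b)
    (ψ : ℕ → ℝ) (hψ0 : ∀ n, 0 ≤ ψ n) (hψmono : Antitone ψ)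
    (hψsum : Summable fun n : ℕ => ψ n * Real.log n) (L : ℕ) (hL : 0 < L) :
    ∀ᵐ β ∂(volume : Measure ℝ), |β| ≤ (L:ℝ) →
      {n : ℕ | 0 < n ∧
        distNearestInt (n * (a * β + b)) * distNearestInt (n * β) < ψ n}.Finite := by
  obtain ⟨w, hw2, hw4, c, hc, hlow⟩ := exp_lower a b hab
  obtain ⟨τ, hτ1, hτ2, hτsq, hτw⟩ := exists_tau w hw2 hw4
  have hτ0 : 0 < τ := by linarith
  have hL1 : (1:ℝ) ≤ L := by exact_mod_cast hL
  have ha : a ≠ 0 := by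
    rintro rfl
    have := hlow 1 one_pos
    simp [distNearestInt] at this
    linarith
  let s : ℕ → ℝ := fun k => ψ (2^k) + (1/τ^2)^k
  let Z : ℕ → ℕ := fun k => ⌈τ^k⌉₊
  have hs0 : ∀ k, 0 < s k := fun k => by
    have := hψ0 (2^k)
    have : 0 < (1/τ^2)^k := by positivity
    simp only [s]; linarith
  have hZ : ∀ k, 1 ≤ Real.sqrt (s k) * Z k := by
    intro k
    have h1 : 1 / τ^k ≤ Real.sqrt (s k) := by
      apply Real.le_sqrt_of_sq_le
      have e : (1 / τ^k)^2 = (1/τ^2)^k := by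
        rw [div_pow, div_pow, one_pow, one_pow, ← pow_mul, ← pow_mul, mul_comm]
      rw [e]; simp only [s]; linarith [hψ0 (2^k)]
    have h2 : τ^k ≤ Z k := Nat.le_ceil _
    calc (1:ℝ) = 1 / τ^k * τ^k := by field_simp
      _ ≤ _ := mul_le_mul h1 h2 (by positivity) (Real.sqrt_nonneg _)
  have hlogZ : ∀ k, Real.log (Z k) ≤ k := by
    intro k
    have h1 : Z k ≤ 2^k := by
      apply Nat.ceil_le.2
      push_cast
      exact pow_le_pow_left₀ hτ0.le hτ2 k
    have h0 : 0 < Z k := Nat.ceil_pos.2 (by positivity)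
    have h1' : (Z k : ℝ) ≤ 2^k := by exact_mod_cast h1
    have h0' : (0:ℝ) < Z k := by exact_mod_cast h0
    calc Real.log (Z k) ≤ Real.log (2^k) := Real.log_le_log h0' h1'
      _ = k * Real.log 2 := Real.log_pow _ _
      _ ≤ k * 1 := by
        apply mul_le_mul_of_nonneg_left _ (by positivity)
        linarith [Real.log_two_lt_d9]
      _ = k := mul_one _
  have hev : ∀ᶠ k : ℕ in Filter.atTop, (τ^w/4)^k < c := by
    have := tendsto_pow_atTop_nhds_zero_of_lt_one (r := τ^w/4) (by positivity)
      (by rw [div_lt_one (by norm_num)]; exact hτw)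
    exact this.eventually (gt_mem_nhds hc)
  obtain ⟨k0, hk0⟩ := Filter.eventually_atTop.1 hev
  have hsep : ∀ k ≥ k0, ∀ z : ℕ, 0 < z → z < Z k →
      1 / ((2 * (4 * L * 2^k) : ℕ):ℝ) ≤ distNearestInt (z * a) ∨
      1 / ((2 * (4 * L * 2^k) : ℕ):ℝ) ≤ distNearestInt (z * b) := by
    intro k hk z hz hzZ
    by_contra hcon
    push Not at hcon
    obtain ⟨c1, c2⟩ := hcon
    have hzt : (z:ℝ) < τ^k := Nat.lt_ceil.1 hzZ
    have h1 := hlow z hz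
    have hz0 : (0:ℝ) < z := by exact_mod_cast hz
    have h2 : (z:ℝ)^w ≤ (τ^w)^k := by
      calc (z:ℝ)^w ≤ (τ^k)^w := Real.rpow_le_rpow hz0.le hzt.le (by linarith)
        _ = (τ^w)^k := by
          rw [← Real.rpow_natCast, ← Real.rpow_natCast, ← Real.rpow_mul hτ0.le,
            ← Real.rpow_mul hτ0.le, mul_comm]
    have h3 : 1 / ((2 * (4 * L * 2^k) : ℕ):ℝ) ≤ 1 / 2^k := by
      apply one_div_le_one_div_of_le (by positivity)
      push_cast
      have : (0:ℝ) < 2^k := by positivity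
      nlinarith
    have h4 : distNearestInt (z * a) * distNearestInt (z * b) ≤ (1/2^k) * (1/2^k) :=
      mul_le_mul (c1.le.trans h3) (c2.le.trans h3) (d_nonneg _) (by positivity)
    have h5 : c ≤ (1/2^k) * (1/2^k) * (τ^w)^k :=
      h1.trans (mul_le_mul h4 h2 (by positivity) (by positivity))
    have h6 : (1/2^k) * (1/2^k) * (τ^w)^k = (τ^w/4)^k := by
      rw [div_pow, show (4:ℝ) = 2 * 2 by norm_num, mul_pow]; field_simp
    rw [h6] at h5
    exact absurd (hk0 k hk) (not_lt.2 h5)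
  have hsum : Summable fun k : ℕ => 2^k * s k * (2 + (k:ℝ)) := by
    have hρ : ‖2/τ^2‖ < 1 := by
      rw [Real.norm_of_nonneg (by positivity), div_lt_one (by positivity)]; exact hτsq
    have A := cond_summable ψ hψ0 hψmono hψsum
    have B0 := (summable_pow_mul_geometric_of_norm_lt_one 0 hρ).mul_left 2
    have B1 := summable_pow_mul_geometric_of_norm_lt_one 1 hρ
    refine (A.add (B0.add B1)).congr fun k => ?_
    have e : (2/τ^2)^k = 2^k * (1/τ^2)^k := by rw [← mul_pow]; congr 1; ring
    simp only [s, e]; ring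
  set C : ℝ := ((2 * (⌈|a|⌉₊ + 1) + 1) * (4 * (2 + 1 / |a|) * 8) * ((9 + 1024 * KK^2) * (16 * L^2)))
    with hC
  have hC0 : 0 ≤ C := by positivity
  have hvol : ∀ k, volume (BB a b (s (k + k0)) L (k + k0)) ≤
      ENNReal.ofReal (C * (2^(k+k0) * s (k+k0) * (2 + ((k+k0 : ℕ):ℝ)))) := by
    intro k
    refine (vol_BB a b _ ha L (k+k0) (Z (k+k0)) hL (hs0 _) (hZ _)
      (hsep _ (by omega))).trans (ENNReal.ofReal_le_ofReal ?_)
    apply mul_le_mul_of_nonneg_left _ hC0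
    apply mul_le_mul_of_nonneg_left _ (mul_nonneg (by positivity) (hs0 _).le)
    linarith [hlogZ (k+k0)]
  have htsum : ∑' k, volume (BB a b (s (k + k0)) L (k + k0)) ≠ ⊤ := by
    have h1 : Summable fun k : ℕ => C * (2^(k+k0) * s (k+k0) * (2 + ((k+k0 : ℕ):ℝ))) :=
      ((summable_nat_add_iff k0).2 hsum).mul_left C
    exact ne_top_of_le_ne_top h1.tsum_ofReal_ne_top (ENNReal.tsum_le_tsum hvol)
  filter_upwards [ae_eventually_notMem htsum] with β hβ hβL
  obtain ⟨K, hK⟩ := Filter.eventually_atTop.1 hβ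
  refine (Set.finite_lt_nat (2^(K+k0))).subset ?_
  rintro n ⟨hn0, hn⟩
  by_contra hlt
  have hge : 2^(K+k0) ≤ n := not_lt.1 hlt
  have hlog : K + k0 ≤ Nat.log 2 n := (Nat.le_log_iff_pow_le (by norm_num) (by omega)).2 hge
  set m := Nat.log 2 n with hm
  have hm1 : 2^m ≤ n := Nat.pow_log_le_self 2 (by omega)
  have hm2 : n < 2^(m+1) := Nat.lt_pow_succ_log_self (by norm_num) n
  apply hK (m - k0) (by omega)
  rw [Nat.sub_add_cancel (by omega)]
  refine ⟨hβL, n, hm1, hm2, hn.trans_le ?_⟩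
  have : 0 < (1/τ^2)^m := by positivity
  have := hψmono hm1
  simp only [s]; linarith

/-- **Convergence theorem, multiplicative variant** (Chow–Yang, Theorem 1.6). -/
theorem convergence_on_lines_multiplicative (a b : ℝ) (hab : MultExpLtFour a b)
    (ψ : ℕ → ℝ) (hψ0 : ∀ n, 0 ≤ ψ n) (hψmono : Antitone ψ)
    (hψsum : Summable fun n : ℕ => ψ n * Real.log n) :
    ∀ᵐ β ∂(volume : Measure ℝ),
      {n : ℕ | 0 < n ∧
        distNearestInt (n * (a * β + b)) * distNearestInt (n * β) < ψ n}.Finite := by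
  have h : ∀ L : ℕ, ∀ᵐ β ∂(volume : Measure ℝ), |β| ≤ ((L + 1 : ℕ) : ℝ) →
      {n : ℕ | 0 < n ∧
        distNearestInt (n * (a * β + b)) * distNearestInt (n * β) < ψ n}.Finite := fun L =>
    main_L a b hab ψ hψ0 hψmono hψsum (L + 1) (Nat.succ_pos L)
  filter_upwards [ae_all_iff.2 h] with β hβ
  obtain ⟨L, hL⟩ := exists_nat_ge |β|
  exact hβ L (hL.trans (by push_cast; linarith))

end
end

section
/- Let (a,b) ∈ ℝ² satisfy ω*(a,b) < 5, and let κ > 2/3. Then for Lebesgue-almost every β ∈ ℝ one has limsup Δ(a(t,s) u(aβ+b, β) ℤ³) / log max(t,s) ≤ κ, where the limsup is taken over pairs (t,s) ∈ ℝ²_{≥0} with max(t,s) → ∞. -/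
/-!
Upper bound in the logarithm law for lines in `SL(3,ℝ)/SL(3,ℤ)` (part of
Chow–Yang, Corollary 1.8): if `ω*(a,b) < 5` and `κ > 2/3`, then for almost
every `β`, `limsup Δ(a(t,s) u(aβ+b, β) ℤ³) / log max(t,s) ≤ κ`, the limsup
being over `(t,s) ∈ ℝ²_{≥0}` with `max(t,s) → ∞`.  The `limsup ≤ κ`
statement is spelled out with explicit quantifiers.
-/

open MeasureTheory Matrix

noncomputable section

/-- `ω*(a,b) < 5`, where `ω*(a,b)` is the dual exponent of `(a,b)`: the supremum of
`w` such that `⟨xa + yb⟩ ≤ (|x|+|y|)^{-w}` for infinitely many nonzero `(x,y) ∈ ℤ²`. -/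
def DualExpLtFive (a b : ℝ) : Prop :=
  ∃ w : ℝ, w < 5 ∧
    {p : ℤ × ℤ | p ≠ 0 ∧
      distNearestInt (p.1 * a + p.2 * b) ≤ ((|p.1| + |p.2| : ℤ) : ℝ) ^ (-w)}.Finite

/-- The diagonal matrix `a(t,s) = diag(e^t, e^s, e^{-t-s})`. -/
def aM (t s : ℝ) : Matrix (Fin 3) (Fin 3) ℝ :=
  !![Real.exp t, 0, 0; 0, Real.exp s, 0; 0, 0, Real.exp (-t - s)]

/-- The unipotent matrix `u(y,x)` with rows `(1,0,y), (0,1,x), (0,0,1)`. -/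
def uM (y x : ℝ) : Matrix (Fin 3) (Fin 3) ℝ := !![1, 0, y; 0, 1, x; 0, 0, 1]

/-- `Δ(g ℤ³) = max_{v ∈ gℤ³ \ {0}} log (1/‖v‖)`, with `‖·‖` the sup norm. -/
def latDelta (g : Matrix (Fin 3) (Fin 3) ℝ) : ℝ :=
  ⨆ v : {v : Fin 3 → ℤ // v ≠ 0},
    Real.log (1 / ‖g.mulVec fun i => ((v : Fin 3 → ℤ) i : ℝ)‖)


def phiL (a b Q δ : ℝ) : (ℤ × ℤ × ℤ) →+ (Fin 3 → ℝ) where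
  toFun v := ![(v.1 : ℝ) / Q, (v.2.1 : ℝ) / Q, ((v.2.2 : ℝ) + v.2.1 * b - v.1 * a) / δ]
  map_zero' := by
    ext i; fin_cases i <;> simp
  map_add' u v := by
    ext i; fin_cases i <;> simp <;> ring

lemma phiL_norm_le (a b Q δ : ℝ) (hQ : 0 < Q) (hδ : 0 < δ) (v : ℤ × ℤ × ℤ) (c : ℝ) (hc : 0 ≤ c) :
    ‖phiL a b Q δ v‖ ≤ c ↔ (|(v.1 : ℝ)| ≤ c * Q ∧ |(v.2.1 : ℝ)| ≤ c * Q ∧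
      |(v.2.2 : ℝ) + v.2.1 * b - v.1 * a| ≤ c * δ) := by
  rw [pi_norm_le_iff_of_nonneg hc, Fin.forall_fin_succ, Fin.forall_fin_succ, Fin.forall_fin_succ]
  simp [phiL, abs_of_pos hQ, abs_of_pos hδ, div_le_iff₀ hQ, div_le_iff₀ hδ]

lemma packing (F : Finset (Fin 3 → ℝ)) (l : ℝ) (hl : 0 < l) (h1 : ∀ u ∈ F, ‖u‖ ≤ 1)
    (hsep : ∀ u ∈ F, ∀ v ∈ F, ‖u - v‖ < l → u = v)
    (hspan : Submodule.span ℝ (F : Set (Fin 3 → ℝ)) ≠ ⊤) :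
    (F.card : ℝ) ≤ (4 / l + 2) ^ 2 := by
  obtain ⟨f, hf0, hf⟩ := Submodule.exists_le_ker_of_lt_top _ (lt_top_iff_ne_top.2 hspan)
  set n : Fin 3 → ℝ := fun i => f (Pi.single i 1) with hn
  have hfn : ∀ u, f u = ∑ i, u i * n i := by
    intro u
    conv_lhs => rw [← Finset.univ_sum_single u]
    rw [map_sum]
    refine Finset.sum_congr rfl fun i _ => ?_
    have : (Pi.single i (u i) : Fin 3 → ℝ) = u i • Pi.single i 1 := by
      rw [← Pi.single_smul]; simp
    rw [this, map_smul, smul_eq_mul]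
  obtain ⟨i, -, hi⟩ := Finset.exists_max_image Finset.univ (fun i => |n i|) Finset.univ_nonempty
  have hni : 0 < |n i| := by
    by_contra h
    apply hf0
    ext j
    have h2 := hi j (Finset.mem_univ _)
    have h3 : |n j| = 0 := le_antisymm (by linarith) (abs_nonneg _)
    simpa [hn] using h3
  have key : ∀ u, f u = 0 → |u i| ≤ |u (i.succAbove 0)| + |u (i.succAbove 1)| := by
    intro u hu
    rw [hfn, Fin.sum_univ_succAbove _ i, Fin.sum_univ_two] at hu
    have h0 := hi (i.succAbove 0) (Finset.mem_univ _)
    have h1 := hi (i.succAbove 1) (Finset.mem_univ _)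
    have : |u i| * |n i| ≤ (|u (i.succAbove 0)| + |u (i.succAbove 1)|) * |n i| := by
      calc |u i| * |n i| = |u (i.succAbove 0) * n (i.succAbove 0) + u (i.succAbove 1) * n (i.succAbove 1)| := by
            rw [← abs_mul, ← abs_neg]; congr 1; linarith
        _ ≤ |u (i.succAbove 0)| * |n (i.succAbove 0)| + |u (i.succAbove 1)| * |n (i.succAbove 1)| := by
            rw [← abs_mul, ← abs_mul]; exact abs_add_le _ _
        _ ≤ _ := by
            rw [add_mul]; gcongr
    exact le_of_mul_le_mul_right this hni
  set G : Finset ℤ := Finset.Icc ⌊-(2 / l)⌋ ⌊2 / l⌋ with hG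
  set g : (Fin 3 → ℝ) → ℤ × ℤ := fun u => (⌊u (i.succAbove 0) * (2 / l)⌋, ⌊u (i.succAbove 1) * (2 / l)⌋) with hg
  have h2l : 0 < 2 / l := by positivity
  have hfl : ∀ x : ℝ, |x| ≤ 1 → ⌊x * (2 / l)⌋ ∈ G := by
    intro x hx
    rw [abs_le] at hx
    rw [hG, Finset.mem_Icc]
    constructor <;> apply Int.floor_le_floor <;> nlinarith
  have hcard : F.card ≤ (G ×ˢ G).card := by
    apply Finset.card_le_card_of_injOn g
    · intro u hu
      have hu1 := h1 u hu
      have := fun j => (norm_le_pi_norm u j).trans hu1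
      simp only [Real.norm_eq_abs] at this
      simp [hg, hfl _ (this _)]
    · intro u hu v hv huv
      apply hsep u hu v hv
      simp only [hg, Prod.mk.injEq] at huv
      have e1 := Int.abs_sub_lt_one_of_floor_eq_floor huv.1
      have e2 := Int.abs_sub_lt_one_of_floor_eq_floor huv.2
      rw [← sub_mul, abs_mul, abs_of_pos h2l, mul_div_assoc', div_lt_one hl] at e1 e2
      have hk : f (u - v) = 0 := by
        have a1 := hf (Submodule.subset_span hu)
        have a2 := hf (Submodule.subset_span hv)
        rw [LinearMap.mem_ker] at a1 a2
        rw [map_sub, a1, a2, sub_zero]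
      have e3 := key _ hk
      simp only [Pi.sub_apply] at e3
      rw [pi_norm_lt_iff hl, Fin.forall_iff_succAbove i]
      simp only [Pi.sub_apply, Real.norm_eq_abs]
      refine ⟨by linarith, ?_⟩
      have p1 := abs_nonneg (u (i.succAbove 0) - v (i.succAbove 0))
      have p2 := abs_nonneg (u (i.succAbove 1) - v (i.succAbove 1))
      rw [Fin.forall_fin_two]
      constructor <;> linarith
  have hGc : (G.card : ℝ) ≤ 4 / l + 2 := by
    rw [hG, Int.card_Icc]
    have hle : ⌊-(2 / l)⌋ ≤ ⌊2 / l⌋ := Int.floor_le_floor (by linarith)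
    have : (((⌊2 / l⌋ + 1 - ⌊-(2 / l)⌋).toNat : ℤ) : ℝ) = ((⌊2 / l⌋ + 1 - ⌊-(2 / l)⌋ : ℤ) : ℝ) := by
      rw [Int.toNat_of_nonneg (by linarith)]
    rw [Int.cast_natCast] at this
    rw [this]
    push_cast
    have q1 := Int.floor_le (2 / l)
    have q2 := Int.lt_floor_add_one (-(2 / l))
    have : 4 / l = 2 * (2 / l) := by ring
    linarith
  calc (F.card : ℝ) ≤ ((G ×ˢ G).card : ℝ) := by exact_mod_cast hcard
    _ = (G.card : ℝ) ^ 2 := by rw [Finset.card_product]; push_cast; ring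
    _ ≤ _ := pow_le_pow_left₀ (Nat.cast_nonneg _) hGc 2

lemma cover (a b Q δ : ℝ) (hQ : 0 < Q) (hδ : 0 < δ) (F : Finset (ℤ × ℤ × ℤ))
    (hF : ∀ v ∈ F, ‖phiL a b Q δ v‖ ≤ 1)
    (hspan : Submodule.span ℝ ((phiL a b Q δ) '' (F : Set (ℤ × ℤ × ℤ))) = ⊤) (θ : ℝ) :
    ∃ w : ℤ × ℤ × ℤ, |(w.1 : ℝ)| ≤ 3 * Q ∧ |(w.2.1 : ℝ)| ≤ 3 * Q ∧
      |(w.2.2 : ℝ) + w.2.1 * b - w.1 * a - θ| ≤ 3 * δ := by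
  obtain ⟨ι, hfin, B, hBs⟩ : ∃ (ι : Type) (_ : Fintype ι) (B : Module.Basis ι ℝ (Fin 3 → ℝ)),
      Set.range B ⊆ (phiL a b Q δ) '' (F : Set (ℤ × ℤ × ℤ)) :=
    ⟨_, Module.Basis.fintypeIndexOfRankLtAleph0 (Module.Basis.ofSpan hspan.ge)
        (Module.rank_lt_aleph0 ℝ (Fin 3 → ℝ)), Module.Basis.ofSpan hspan.ge,
      Module.Basis.ofSpan_subset hspan.ge⟩
  set m : Fin 3 → ℝ := ![0, 0, θ / δ] with hm
  have h1 := ZSpan.norm_fract_le B m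
  have h2 : ∑ i, ‖B i‖ ≤ 3 := by
    calc ∑ i, ‖B i‖ ≤ ∑ i : ι, (1 : ℝ) := by
          refine Finset.sum_le_sum fun i _ => ?_
          obtain ⟨v, hv, hv'⟩ := hBs ⟨i, rfl⟩
          rw [← hv']; exact hF v hv
      _ = 3 := by
          have := Module.finrank_eq_card_basis B
          simp at this
          simp [← this]
  have h3 : ((ZSpan.floor B m : _) : Fin 3 → ℝ) ∈ (phiL a b Q δ).range := by
    have : Submodule.span ℤ (Set.range B) ≤ AddSubgroup.toIntSubmodule (phiL a b Q δ).range := by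
      rw [Submodule.span_le]
      intro x hx
      obtain ⟨v, hv, hv'⟩ := hBs hx
      exact ⟨v, hv'⟩
    exact this (ZSpan.floor B m).2
  obtain ⟨w, hw⟩ := h3
  refine ⟨w, ?_⟩
  have h4 : ‖m - phiL a b Q δ w‖ ≤ 3 := by
    rw [hw]; exact h1.trans h2
  rw [pi_norm_le_iff_of_nonneg (by norm_num), Fin.forall_fin_succ, Fin.forall_fin_succ, Fin.forall_fin_succ] at h4
  simp only [phiL, hm] at h4
  simp [abs_of_pos hQ, div_le_iff₀ hQ] at h4
  refine ⟨h4.1, h4.2.1, ?_⟩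
  have h5 := h4.2.2
  rw [← sub_div, abs_div, abs_of_pos hδ, div_le_iff₀ hδ, abs_sub_comm] at h5
  exact h5

lemma spread (a b Q δ : ℝ) (hQ : 1 ≤ Q) (hδ : 0 < δ) (hδ1 : 9 * δ ≤ 1) (F : Finset (ℤ × ℤ × ℤ))
    (hF : ∀ v ∈ F, ‖phiL a b Q δ v‖ ≤ 1)
    (hspan : Submodule.span ℝ ((phiL a b Q δ) '' (F : Set (ℤ × ℤ × ℤ))) = ⊤) :
    (F.card : ℝ) ≤ 1458 * Q ^ 2 * δ := by
  have hQ0 : 0 < Q := by linarith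
  choose w hw1 hw2 hw3 using fun j : ℕ => cover a b Q δ hQ0 hδ F hF hspan (9 * δ * j)
  set J : ℕ := ⌊1 / (9 * δ)⌋₊ with hJ
  have h9 : 1 ≤ 1 / (9 * δ) := by rw [le_div_iff₀ (by positivity)]; linarith
  have hJ1 : (J : ℝ) * (9 * δ) ≤ 1 := by
    have := Nat.floor_le (show 0 ≤ 1 / (9 * δ) by positivity)
    rwa [le_div_iff₀ (by positivity)] at this
  have hJ2 : 1 ≤ J * (18 * δ) := by
    have h := Nat.lt_floor_add_one (1 / (9 * δ))
    have h' : 1 ≤ J := by rw [hJ]; exact Nat.le_floor (by simpa using h9)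
    have h'' : (1 : ℝ) ≤ J := by exact_mod_cast h'
    rw [div_lt_iff₀ (by positivity)] at h
    nlinarith
  set G : Finset ℤ := Finset.Icc (-⌊4 * Q⌋) ⌊4 * Q⌋ with hG
  have hGm : ∀ z : ℤ, |(z : ℝ)| ≤ 4 * Q → z ∈ G := by
    intro z hz
    rw [hG, Finset.mem_Icc, ← abs_le, Int.le_floor]
    push_cast; exact hz
  have hcard : (Finset.range J ×ˢ F).card ≤ (G ×ˢ G).card := by
    apply Finset.card_le_card_of_injOn (fun p => ((w p.1).1 + p.2.1, (w p.1).2.1 + p.2.2.1))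
    · rintro ⟨j, v⟩ hp
      simp only [Finset.coe_product, Set.mem_prod, Finset.mem_coe] at hp ⊢
      have hv := (phiL_norm_le a b Q δ hQ0 hδ v 1 (by norm_num)).1 (hF v hp.2)
      constructor
      · apply hGm
        push_cast
        have := abs_add_le ((w j).1 : ℝ) (v.1 : ℝ)
        linarith [hw1 j, hv.1]
      · apply hGm
        push_cast
        have := abs_add_le ((w j).2.1 : ℝ) (v.2.1 : ℝ)
        linarith [hw2 j, hv.2.1]
    · rintro ⟨j, v⟩ hp ⟨j', v'⟩ hp' heq
      simp only [Finset.coe_product, Set.mem_prod, Finset.mem_coe, Finset.mem_range] at hp hp'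
      simp only [Prod.mk.injEq] at heq
      obtain ⟨e1, e2⟩ := heq
      have hv := ((phiL_norm_le a b Q δ hQ0 hδ v 1 (by norm_num)).1 (hF v hp.2)).2.2
      have hv' := ((phiL_norm_le a b Q δ hQ0 hδ v' 1 (by norm_num)).1 (hF v' hp'.2)).2.2
      have f1 : ((w j).1 : ℝ) + v.1 = (w j').1 + v'.1 := by exact_mod_cast e1
      have f2 : ((w j).2.1 : ℝ) + v.2.1 = (w j').2.1 + v'.2.1 := by exact_mod_cast e2
      have g1 := hw3 j
      have g2 := hw3 j'
      have jl : (j : ℝ) + 1 ≤ J := by exact_mod_cast hp.1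
      have jl' : (j' : ℝ) + 1 ≤ J := by exact_mod_cast hp'.1
      have j0 : (0 : ℝ) ≤ j := by positivity
      have j0' : (0 : ℝ) ≤ j' := by positivity
      rw [abs_le] at hv hv' g1 g2
      have f1a : (((w j).1 : ℝ) + v.1) * a = ((w j').1 + v'.1) * a := by rw [f1]
      have f2b : (((w j).2.1 : ℝ) + v.2.1) * b = ((w j').2.1 + v'.2.1) * b := by rw [f2]
      have m1 : 9 * δ * (j + 1) ≤ 9 * δ * J := by gcongr
      have m1' : 9 * δ * (j' + 1) ≤ 9 * δ * J := by gcongr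
      have m2 : 0 ≤ 9 * δ * j := by positivity
      have m2' : 0 ≤ 9 * δ * j' := by positivity
      have e3 : (w j).2.2 + v.2.2 = (w j').2.2 + v'.2.2 := by
        have l1 : (((w j).2.2 + v.2.2 : ℤ) : ℝ) < (((w j').2.2 + v'.2.2 + 1 : ℤ) : ℝ) := by
          push_cast; linarith [hv.1, hv.2, hv'.1, hv'.2, g1.1, g1.2, g2.1, g2.2]
        have l2 : (((w j').2.2 + v'.2.2 : ℤ) : ℝ) < (((w j).2.2 + v.2.2 + 1 : ℤ) : ℝ) := by
          push_cast; linarith [hv.1, hv.2, hv'.1, hv'.2, g1.1, g1.2, g2.1, g2.2]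
        have l1' := Int.cast_lt.1 l1
        have l2' := Int.cast_lt.1 l2
        omega
      have f3 : ((w j).2.2 : ℝ) + v.2.2 = (w j').2.2 + v'.2.2 := by exact_mod_cast e3
      have hjj : j = j' := by
        have l1 : δ * (j : ℝ) < δ * (j' + 1) := by
          linarith [hv.1, hv.2, hv'.1, hv'.2, g1.1, g1.2, g2.1, g2.2]
        have l2 : δ * (j' : ℝ) < δ * (j + 1) := by
          linarith [hv.1, hv.2, hv'.1, hv'.2, g1.1, g1.2, g2.1, g2.2]
        have l1' := lt_of_mul_lt_mul_left l1 hδ.le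
        have l2' := lt_of_mul_lt_mul_left l2 hδ.le
        have l1'' : j < j' + 1 := by exact_mod_cast l1'
        have l2'' : j' < j + 1 := by exact_mod_cast l2'
        omega
      subst hjj
      ext
      · rfl
      · simpa using e1
      · simpa using e2
      · simpa using e3
  have hGc : (G.card : ℝ) ≤ 9 * Q := by
    rw [hG, Int.card_Icc]
    have h0 : 0 ≤ ⌊4 * Q⌋ := Int.floor_nonneg.2 (by positivity)
    have : (((⌊4 * Q⌋ + 1 - -⌊4 * Q⌋).toNat : ℤ) : ℝ) = ((⌊4 * Q⌋ + 1 - -⌊4 * Q⌋ : ℤ) : ℝ) := by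
      rw [Int.toNat_of_nonneg (by linarith)]
    rw [Int.cast_natCast] at this
    rw [this]
    push_cast
    linarith [Int.floor_le (4 * Q)]
  have h6 : (J : ℝ) * F.card ≤ (9 * Q) ^ 2 := by
    calc (J : ℝ) * F.card = ((Finset.range J ×ˢ F).card : ℝ) := by
          rw [Finset.card_product]; simp
      _ ≤ ((G ×ˢ G).card : ℝ) := by exact_mod_cast hcard
      _ = (G.card : ℝ) ^ 2 := by rw [Finset.card_product]; push_cast; ring
      _ ≤ _ := by gcongr
  calc (F.card : ℝ) ≤ (J * (18 * δ)) * F.card := le_mul_of_one_le_left (by positivity) hJ2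
    _ = 18 * δ * (J * F.card) := by ring
    _ ≤ 18 * δ * (9 * Q) ^ 2 := by gcongr
    _ = _ := by ring

lemma one_le_abs_add (p : ℤ × ℤ) (hp : p ≠ 0) : (1 : ℝ) ≤ ((|p.1| + |p.2| : ℤ) : ℝ) := by
  have : 1 ≤ |p.1| + |p.2| := by
    by_contra h
    have h1 := abs_nonneg p.1
    have h2 := abs_nonneg p.2
    apply hp
    ext
    · exact abs_eq_zero.1 (by omega)
    · exact abs_eq_zero.1 (by omega)
  exact_mod_cast this

lemma dioph (a b : ℝ) (h : DualExpLtFive a b) : ∃ w c : ℝ, 3 ≤ w ∧ w < 5 ∧ 0 < c ∧ c ≤ 1 ∧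
    ∀ p : ℤ × ℤ, p ≠ 0 → ∀ z : ℤ,
      c * ((|p.1| + |p.2| : ℤ) : ℝ) ^ (-w) ≤ |(z : ℝ) + p.2 * b - p.1 * a| := by
  obtain ⟨w, hw, hfin⟩ := h
  set X := {p : ℤ × ℤ | p ≠ 0 ∧
      distNearestInt (p.1 * a + p.2 * b) ≤ ((|p.1| + |p.2| : ℤ) : ℝ) ^ (-w)} with hX
  have hpos : ∀ p : ℤ × ℤ, p ≠ 0 → 0 < distNearestInt (p.1 * a + p.2 * b) := by
    intro p hp
    by_contra hneg
    have h0 : distNearestInt (p.1 * a + p.2 * b) = 0 := le_antisymm (not_lt.1 hneg) (abs_nonneg _)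
    have h0' : (p.1 * a + p.2 * b : ℝ) = (round (p.1 * a + p.2 * b) : ℤ) := by
      unfold distNearestInt at h0
      linarith [abs_eq_zero.1 h0]
    have hinj : Function.Injective (fun n : ℕ => ((n : ℤ) + 1) • p) := by
      intro n m hnm
      have : ((n : ℤ) + 1) = (m : ℤ) + 1 := smul_left_injective ℤ hp hnm
      omega
    refine Set.infinite_range_of_injective hinj (hfin.subset ?_)
    rintro _ ⟨n, rfl⟩
    have hne : ((n : ℤ) + 1) • p ≠ 0 := smul_ne_zero (by omega) hp
    refine ⟨hne, ?_⟩
    have e : ((((n : ℤ) + 1) • p).1 * a + (((n : ℤ) + 1) • p).2 * b : ℝ)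
        = ((((n : ℤ) + 1) * round (p.1 * a + p.2 * b) : ℤ) : ℝ) := by
      simp only [Prod.smul_fst, Prod.smul_snd, smul_eq_mul]
      push_cast
      rw [← h0']; ring
    have : distNearestInt ((((n : ℤ) + 1) • p).1 * a + (((n : ℤ) + 1) • p).2 * b) = 0 := by
      rw [e]; unfold distNearestInt; rw [round_intCast]; simp
    rw [this]
    have := one_le_abs_add _ hne
    positivity
  obtain ⟨c, hc0, hc1, hc⟩ : ∃ c : ℝ, 0 < c ∧ c ≤ 1 ∧
      ∀ p ∈ X, c ≤ distNearestInt (p.1 * a + p.2 * b) := by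
    by_cases hne : X.Nonempty
    · obtain ⟨p0, hp0, hmin⟩ := Set.exists_min_image X (fun p => distNearestInt (p.1 * a + p.2 * b)) hfin hne
      refine ⟨min 1 (distNearestInt (p0.1 * a + p0.2 * b)), lt_min one_pos (hpos _ hp0.1), min_le_left _ _, ?_⟩
      intro p hp
      exact (min_le_right _ _).trans (hmin p hp)
    · exact ⟨1, one_pos, le_rfl, fun p hp => (hne ⟨p, hp⟩).elim⟩
  refine ⟨max w 3, c, le_max_right _ _, max_lt hw (by norm_num), hc0, hc1, ?_⟩
  have main : ∀ p : ℤ × ℤ, p ≠ 0 →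
      c * ((|p.1| + |p.2| : ℤ) : ℝ) ^ (-(max w 3)) ≤ distNearestInt (p.1 * a + p.2 * b) := by
    intro p hp
    have h1 := one_le_abs_add p hp
    by_cases hpX : p ∈ X
    · refine le_trans ?_ (hc p hpX)
      refine mul_le_of_le_one_right hc0.le ?_
      apply Real.rpow_le_one_of_one_le_of_nonpos h1
      have := le_max_right w 3
      linarith
    · have h2 : ((|p.1| + |p.2| : ℤ) : ℝ) ^ (-w) < distNearestInt (p.1 * a + p.2 * b) := by
        by_contra h3
        exact hpX ⟨hp, not_lt.1 h3⟩
      refine le_trans ?_ h2.le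
      calc c * ((|p.1| + |p.2| : ℤ) : ℝ) ^ (-(max w 3)) ≤ 1 * ((|p.1| + |p.2| : ℤ) : ℝ) ^ (-w) := by
            gcongr
            exact le_max_left _ _
        _ = _ := one_mul _
  intro p hp z
  have h1 := main (-p.1, p.2) (by
    intro h; apply hp; rw [Prod.ext_iff] at h ⊢; simpa using h)
  simp only [abs_neg] at h1
  refine h1.trans ?_
  unfold distNearestInt
  refine (round_le _ (-z)).trans (le_of_eq ?_)
  push_cast
  congr 1; ring

lemma count (a b w c : ℝ) (hw3 : 3 ≤ w) (hw5 : w < 5) (hc0 : 0 < c) (hc1 : c ≤ 1)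
    (hd : ∀ p : ℤ × ℤ, p ≠ 0 → ∀ z : ℤ,
      c * ((|p.1| + |p.2| : ℤ) : ℝ) ^ (-w) ≤ |(z : ℝ) + p.2 * b - p.1 * a|)
    (Q δ : ℝ) (hQ : 1 ≤ Q) (hδ : 0 < δ) (hδ1 : 9 * δ ≤ 1) (F : Finset (ℤ × ℤ × ℤ))
    (hF : ∀ v ∈ F, ‖phiL a b Q δ v‖ ≤ 1) :
    (F.card : ℝ) ≤ 1458 * Q ^ 2 * δ + 32 * (32 / c * (Q ^ w * δ)) ^ (2 / (w + 1)) + 8 := by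
  have hQ0 : 0 < Q := by linarith
  set Z : ℝ := 32 / c * (Q ^ w * δ) with hZ
  have hZ0 : 0 < Z := by positivity
  have hpw : 0 ≤ 32 * Z ^ (2 / (w + 1)) := by positivity
  by_cases hspan : Submodule.span ℝ ((phiL a b Q δ) '' (F : Set (ℤ × ℤ × ℤ))) = ⊤
  · have := spread a b Q δ hQ hδ hδ1 F hF hspan
    linarith
  set l : ℝ := (1 / Z) ^ (1 / (w + 1)) with hl
  have hl0 : 0 < l := by positivity
  have hlw : l ^ (w + 1) = 1 / Z := by
    rw [hl, ← Real.rpow_mul (by positivity), one_div_mul_cancel (by linarith), Real.rpow_one]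
  have hsep : ∀ v : ℤ × ℤ × ℤ, ‖phiL a b Q δ v‖ < l → v = 0 := by
    intro v hv
    obtain ⟨h1, h2, h3⟩ := (phiL_norm_le a b Q δ hQ0 hδ v _ (norm_nonneg _)).1 le_rfl
    set ν := ‖phiL a b Q δ v‖ with hν
    by_cases hp : (v.1, v.2.1) = ((0, 0) : ℤ × ℤ)
    · simp only [Prod.mk.injEq] at hp
      rw [hp.1, hp.2] at h3
      simp only [Int.cast_zero, zero_mul, add_zero, sub_zero] at h3
      have hlδ : l * δ ≤ 1 := by
        have : l ≤ 1 / δ := by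
          have h1Z : 1 / Z ≤ 1 / δ := by
            apply one_div_le_one_div_of_le hδ
            rw [hZ]
            have : 1 ≤ Q ^ w := Real.one_le_rpow hQ (by linarith)
            have h2 : 1 ≤ 32 / c := by rw [le_div_iff₀ hc0]; linarith
            calc δ = 1 * (1 * δ) := by ring
              _ ≤ _ := by gcongr
          calc l ≤ (1 / δ) ^ (1 / (w + 1)) := by
                rw [hl]; gcongr
            _ ≤ (1 / δ) ^ (1 : ℝ) := by
                apply Real.rpow_le_rpow_of_exponent_le
                · rw [le_div_iff₀ hδ]; linarith
                · rw [div_le_one (by linarith)]; linarith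
            _ = _ := Real.rpow_one _
        rwa [le_div_iff₀ hδ] at this
      have h4 : |(v.2.2 : ℝ)| < 1 := by nlinarith
      have h5 : v.2.2 = 0 := by
        have : |v.2.2| < 1 := by exact_mod_cast h4
        exact Int.abs_lt_one_iff.1 this
      ext
      · exact hp.1
      · exact hp.2
      · exact h5
    · exfalso
      have hd' := hd (v.1, v.2.1) hp v.2.2
      have h1' := one_le_abs_add (v.1, v.2.1) hp
      simp only at hd' h1'
      have h6 : ((|v.1| + |v.2.1| : ℤ) : ℝ) ≤ 2 * l * Q := by
        push_cast; nlinarith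
      have h7 : c * (2 * l * Q) ^ (-w) < l * δ := by
        calc c * (2 * l * Q) ^ (-w) ≤ c * ((|v.1| + |v.2.1| : ℤ) : ℝ) ^ (-w) := by
              gcongr 1
              apply Real.rpow_le_rpow_of_nonpos (by linarith) h6 (by linarith)
          _ ≤ ν * δ := hd'.trans h3
          _ < l * δ := by gcongr
      rw [Real.rpow_neg (by positivity), ← div_eq_mul_inv, div_lt_iff₀ (by positivity),
        Real.mul_rpow (by positivity) hQ0.le, Real.mul_rpow (by norm_num) hl0.le] at h7
      have h8 : l * δ * ((2 : ℝ) ^ w * l ^ w * Q ^ w) = (2 : ℝ) ^ w * (l ^ (w + 1) * (Q ^ w * δ)) := by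
        rw [Real.rpow_add_one hl0.ne']; ring
      have h9 : l ^ (w + 1) * (Q ^ w * δ) = c / 32 := by
        rw [hlw, hZ]; field_simp
      have h10 : (2 : ℝ) ^ w ≤ 32 := by
        calc (2 : ℝ) ^ w ≤ (2 : ℝ) ^ (5 : ℝ) := Real.rpow_le_rpow_of_exponent_le (by norm_num) hw5.le
          _ = 32 := by norm_num
      rw [h8, h9] at h7
      nlinarith
  have hinj : Set.InjOn (phiL a b Q δ) F := by
    intro u _ v _ huv
    have : u - v = 0 := hsep (u - v) (by rw [map_sub, huv, sub_self, norm_zero]; exact hl0)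
    exact sub_eq_zero.1 this
  have hpk := packing (F.image (phiL a b Q δ)) l hl0 (by
      intro u hu
      obtain ⟨v, hv, rfl⟩ := Finset.mem_image.1 hu
      exact hF v hv) (by
      intro u hu v hv huv
      obtain ⟨u, hu, rfl⟩ := Finset.mem_image.1 hu
      obtain ⟨v, hv, rfl⟩ := Finset.mem_image.1 hv
      rw [← map_sub] at huv
      rw [sub_eq_zero.1 (hsep _ huv)]) (by simpa using hspan)
  rw [Finset.card_image_of_injOn hinj] at hpk
  have hl2 : Z ^ (2 / (w + 1)) = (1 / l) ^ 2 := by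
    rw [hl, one_div Z, Real.inv_rpow hZ0.le, div_inv_eq_mul, one_mul, ← Real.rpow_natCast,
      ← Real.rpow_mul hZ0.le]
    congr 1
    push_cast; ring
  have : 0 ≤ 1458 * Q ^ 2 * δ := by positivity
  rw [hl2]
  have e : 4 / l = 4 * (1 / l) := by ring
  rw [e] at hpk
  nlinarith [sq_nonneg (4 * (1 / l) - 2)]

lemma volI (a b : ℝ) (ha : a ≠ 0) (p1 p2 q : ℤ) (X μ M ρ1 ρ2 : ℝ) (hX : 0 < X) (hq : X ≤ |(q : ℝ)|)
    (hμ : 0 < μ) (hρ : (ρ1 = μ ∧ ρ2 = M) ∨ (ρ1 = M ∧ ρ2 = μ)) :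
    volume {β : ℝ | |(p1 : ℝ) + q * (a * β + b)| ≤ ρ1 ∧ |(p2 : ℝ) + q * β| ≤ ρ2} ≤
      ENNReal.ofReal (2 * ((1 + 1 / |a|) * μ / X)) := by
  have ha' : 0 < |a| := abs_pos.2 ha
  have hq0 : 0 < |(q : ℝ)| := hX.trans_le hq
  have hqne : (q : ℝ) ≠ 0 := abs_pos.1 hq0
  have hsub : ∃ x : ℝ, {β : ℝ | |(p1 : ℝ) + q * (a * β + b)| ≤ ρ1 ∧ |(p2 : ℝ) + q * β| ≤ ρ2} ⊆
      Metric.closedBall x ((1 + 1 / |a|) * μ / X) := by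
    rcases hρ with ⟨h1, h2⟩ | ⟨h1, h2⟩
    · refine ⟨-(p1 + q * b) / (q * a), fun β hβ => ?_⟩
      have h := hβ.1
      rw [h1] at h
      rw [Metric.mem_closedBall, Real.dist_eq]
      have e : β - -(p1 + q * b) / (q * a) = ((p1 : ℝ) + q * (a * β + b)) / (q * a) := by
        field_simp; ring
      rw [e, abs_div, abs_mul]
      calc |(p1 : ℝ) + q * (a * β + b)| / (|(q : ℝ)| * |a|) ≤ μ / (X * |a|) := by gcongr
        _ = (0 + 1 / |a|) * μ / X := by field_simp; ring
        _ ≤ _ := by gcongr; norm_num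
    · refine ⟨-p2 / q, fun β hβ => ?_⟩
      have h := hβ.2
      rw [h2] at h
      rw [Metric.mem_closedBall, Real.dist_eq]
      have e : β - -p2 / q = ((p2 : ℝ) + q * β) / q := by
        field_simp; ring
      rw [e, abs_div]
      calc |(p2 : ℝ) + q * β| / |(q : ℝ)| ≤ μ / X := by gcongr
        _ = (1 + 0) * μ / X := by ring
        _ ≤ _ := by gcongr; positivity
  obtain ⟨x, hx⟩ := hsub
  calc _ ≤ volume (Metric.closedBall x ((1 + 1 / |a|) * μ / X)) := measure_mono hx
    _ = _ := Real.volume_closedBall _ _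

lemma volEX (a b w c : ℝ) (ha : a ≠ 0) (hw3 : 3 ≤ w) (hw5 : w < 5) (hc0 : 0 < c) (hc1 : c ≤ 1)
    (hd : ∀ p : ℤ × ℤ, p ≠ 0 → ∀ z : ℤ,
      c * ((|p.1| + |p.2| : ℤ) : ℝ) ^ (-w) ≤ |(z : ℝ) + p.2 * b - p.1 * a|)
    (B X μ M ρ1 ρ2 : ℝ) (hB : 0 ≤ B) (hX : 1 ≤ X) (hμ : 0 < μ) (hμM : μ ≤ M)
    (hM : 9 * ((1 + |a|) * M) ≤ 1)
    (hρ : (ρ1 = μ ∧ ρ2 = M) ∨ (ρ1 = M ∧ ρ2 = μ)) :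
    volume {β : ℝ | |β| ≤ B ∧ ∃ p1 p2 q : ℤ, X ≤ |(q : ℝ)| ∧ |(q : ℝ)| ≤ 2 * X ∧
      |(p1 : ℝ) + q * (a * β + b)| ≤ ρ1 ∧ |(p2 : ℝ) + q * β| ≤ ρ2} ≤
      ENNReal.ofReal ((1458 * (2 * (B + 1) * X) ^ 2 * ((1 + |a|) * M) +
        32 * (32 / c * ((2 * (B + 1) * X) ^ w * ((1 + |a|) * M))) ^ (2 / (w + 1)) + 8) *
        (2 * ((1 + 1 / |a|) * μ / X))) := by
  set Q := 2 * (B + 1) * X with hQ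
  set δ := (1 + |a|) * M with hδ
  have hM0 : 0 < M := hμ.trans_le hμM
  have ha0 := abs_nonneg a
  have hδ0 : 0 < δ := by positivity
  have hQ1 : 1 ≤ Q := by rw [hQ]; nlinarith
  have hcount := count a b w c hw3 hw5 hc0 hc1 hd Q δ hQ1 hδ0 hM
  set N := 1458 * Q ^ 2 * δ + 32 * (32 / c * (Q ^ w * δ)) ^ (2 / (w + 1)) + 8 with hN
  have hN0 : 0 ≤ N := by
    have : 0 < Q := by linarith
    positivity
  set S : Set (ℤ × ℤ × ℤ) := {v | ‖phiL a b Q δ v‖ ≤ 1 ∧ X ≤ |(v.2.1 : ℝ)|} with hS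
  have hSfin : S.Finite := by
    by_contra hinf
    obtain ⟨F, hF, hFc⟩ := Set.Infinite.exists_subset_card_eq hinf (⌊N⌋₊ + 1)
    have h1 := hcount F (fun v hv => (hF hv).1)
    rw [hFc] at h1
    push_cast at h1
    linarith [Nat.lt_floor_add_one N]
  set F := hSfin.toFinset with hF
  have hFS : ∀ v ∈ F, v ∈ S := fun v hv => hSfin.mem_toFinset.1 hv
  have hFc := hcount F (fun v hv => (hFS v hv).1)
  have hρM : ρ1 ≤ M ∧ ρ2 ≤ M := by
    rcases hρ with ⟨h1, h2⟩ | ⟨h1, h2⟩ <;> constructor <;> linarith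
  have hM1 : M ≤ 1 := by nlinarith
  have hsub : {β : ℝ | |β| ≤ B ∧ ∃ p1 p2 q : ℤ, X ≤ |(q : ℝ)| ∧ |(q : ℝ)| ≤ 2 * X ∧
      |(p1 : ℝ) + q * (a * β + b)| ≤ ρ1 ∧ |(p2 : ℝ) + q * β| ≤ ρ2} ⊆
      ⋃ v ∈ F, {β : ℝ | |(v.2.2 : ℝ) + v.2.1 * (a * β + b)| ≤ ρ1 ∧ |(v.1 : ℝ) + v.2.1 * β| ≤ ρ2} := by
    rintro β ⟨hβ, p1, p2, q, hq1, hq2, h1, h2⟩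
    rw [Set.mem_iUnion₂]
    refine ⟨(p2, q, p1), ?_, h1, h2⟩
    rw [hF, hSfin.mem_toFinset]
    refine ⟨?_, hq1⟩
    rw [phiL_norm_le a b Q δ (by linarith) hδ0 _ 1 (by norm_num)]
    simp only [one_mul]
    refine ⟨?_, ?_, ?_⟩
    · have e : (p2 : ℝ) = (p2 + q * β) - q * β := by ring
      rw [e]
      have h3 : |(q : ℝ) * β| ≤ 2 * X * B := by
        rw [abs_mul]; gcongr
      have := abs_sub ((p2 : ℝ) + q * β) (q * β)
      rw [hQ]; nlinarith [hρM.2]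
    · rw [hQ]; nlinarith
    · have e : (p1 : ℝ) + q * b - p2 * a = (p1 + q * (a * β + b)) - a * (p2 + q * β) := by ring
      rw [e]
      have h3 : |a * ((p2 : ℝ) + q * β)| ≤ |a| * M := by
        rw [abs_mul]; gcongr; linarith [hρM.2]
      have := abs_sub ((p1 : ℝ) + q * (a * β + b)) (a * (p2 + q * β))
      rw [hδ]; linarith [hρM.1]
  calc _ ≤ volume (⋃ v ∈ F, {β : ℝ | |(v.2.2 : ℝ) + v.2.1 * (a * β + b)| ≤ ρ1 ∧
          |(v.1 : ℝ) + v.2.1 * β| ≤ ρ2}) := measure_mono hsub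
    _ ≤ ∑ v ∈ F, volume {β : ℝ | |(v.2.2 : ℝ) + v.2.1 * (a * β + b)| ≤ ρ1 ∧
          |(v.1 : ℝ) + v.2.1 * β| ≤ ρ2} := measure_biUnion_finset_le _ _
    _ ≤ ∑ v ∈ F, ENNReal.ofReal (2 * ((1 + 1 / |a|) * μ / X)) := by
        refine Finset.sum_le_sum fun v hv => ?_
        exact volI a b ha _ _ _ X μ M ρ1 ρ2 (by linarith) (hFS v hv).2 hμ hρ
    _ = ENNReal.ofReal (F.card * (2 * ((1 + 1 / |a|) * μ / X))) := by
        rw [Finset.sum_const, nsmul_eq_mul, ENNReal.ofReal_mul (p := (F.card : ℝ)) (Nat.cast_nonneg _),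
          ENNReal.ofReal_natCast]
    _ ≤ _ := by
        apply ENNReal.ofReal_le_ofReal
        gcongr

lemma term2 (w P D : ℝ) (hw3 : 3 ≤ w) (hw5 : w < 5) (hP : 0 < P) (hD : 0 < D) :
    ∃ C θ : ℝ, 0 < C ∧ 0 < θ ∧ θ ≤ 1 ∧ ∀ n m r X : ℝ, 0 ≤ m → m ≤ n → 0 < r → r ≤ 2 → 1 ≤ X →
      X ≤ Real.exp (n + m + 2) * r →
      Real.exp (-n) * r / X * (P * (X ^ w * (D * (Real.exp (-m) * r)))) ^ (2 / (w + 1)) ≤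
        C * Real.exp (-θ * n) := by
  set α := 2 / (w + 1) with hα
  have hw1 : 0 < w + 1 := by linarith
  have hα0 : 0 < α := by positivity
  have hα2 : α ≤ 1 / 2 := by rw [hα, div_le_div_iff₀ hw1 (by norm_num)]; linarith
  have hα3 : 1 / 3 < α := by rw [hα, div_lt_div_iff₀ (by norm_num) hw1]; linarith
  have hwα : w * α - 1 = 1 - α := by rw [hα]; field_simp; ring
  refine ⟨2 * ((P * D * 2) ^ α * (2 * Real.exp 2) ^ (1 - α)), 3 * α - 1, by positivity, by linarith, by linarith, ?_⟩
  intro n m r X hm hmn hr hr2 hX hXY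
  have hX0 : 0 < X := by linarith
  have e1 : (P * (X ^ w * (D * (Real.exp (-m) * r)))) ^ α
      = (P * D * r) ^ α * X ^ (w * α) * Real.exp (-m * α) := by
    have : P * (X ^ w * (D * (Real.exp (-m) * r))) = (P * D * r) * X ^ w * Real.exp (-m) := by ring
    rw [this, Real.mul_rpow (by positivity) (by positivity), Real.mul_rpow (by positivity) (by positivity),
      ← Real.rpow_mul hX0.le, Real.exp_mul]
  have e2 : X ^ (w * α) = X ^ (1 - α) * X := by
    rw [← hwα, Real.rpow_sub_one hX0.ne']; field_simp
  have e3 : X ^ (1 - α) ≤ (2 * Real.exp 2) ^ (1 - α) * Real.exp ((n + m) * (1 - α)) := by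
    have h : X ≤ 2 * Real.exp 2 * Real.exp (n + m) := by
      calc X ≤ Real.exp (n + m + 2) * r := hXY
        _ ≤ Real.exp (n + m + 2) * 2 := by gcongr
        _ = _ := by rw [Real.exp_add (n + m)]; ring
    calc X ^ (1 - α) ≤ (2 * Real.exp 2 * Real.exp (n + m)) ^ (1 - α) := by
          apply Real.rpow_le_rpow hX0.le h (by linarith)
      _ = _ := by rw [Real.mul_rpow (by positivity) (by positivity), ← Real.exp_mul]
  have e4 : Real.exp (-n) * Real.exp ((n + m) * (1 - α)) * Real.exp (-m * α) ≤ Real.exp (-(3 * α - 1) * n) := by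
    rw [← Real.exp_add, ← Real.exp_add, Real.exp_le_exp]
    nlinarith
  rw [e1, e2]
  calc Real.exp (-n) * r / X * ((P * D * r) ^ α * (X ^ (1 - α) * X) * Real.exp (-m * α))
      = Real.exp (-n) * r * ((P * D * r) ^ α * X ^ (1 - α) * Real.exp (-m * α)) := by
        field_simp
    _ ≤ Real.exp (-n) * 2 * ((P * D * 2) ^ α * ((2 * Real.exp 2) ^ (1 - α) * Real.exp ((n + m) * (1 - α))) * Real.exp (-m * α)) := by
        gcongr
    _ = 2 * ((P * D * 2) ^ α * (2 * Real.exp 2) ^ (1 - α)) * (Real.exp (-n) * Real.exp ((n + m) * (1 - α)) * Real.exp (-m * α)) := by ring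
    _ ≤ _ := by gcongr

lemma polyexp (κ θ : ℝ) (hκ : κ ≤ 1) (hθ : 0 < θ) : ∃ C : ℝ, 0 < C ∧ ∀ n : ℝ, 0 ≤ n →
    (n + 1) * Real.exp (-θ * n) ≤ C * (n + 1) ^ (-(3 * κ)) := by
  refine ⟨24 / θ ^ 4 * Real.exp θ, by positivity, fun n hn => ?_⟩
  have h1 := Real.pow_div_factorial_le_exp (θ * (n + 1)) (by positivity) 4
  have h2 : (n + 1) ^ (-(3 : ℝ)) ≤ (n + 1) ^ (-(3 * κ)) :=
    Real.rpow_le_rpow_of_exponent_le (by linarith) (by linarith)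
  have h3 : (n + 1) ^ (-(3 : ℝ)) = ((n + 1) ^ 3)⁻¹ := by
    rw [Real.rpow_neg (by linarith)]; norm_cast
  have h4 : ((4).factorial : ℝ) = 24 := by norm_num [Nat.factorial]
  rw [h4] at h1
  refine le_trans ?_ (mul_le_mul_of_nonneg_left h2 (by positivity))
  rw [h3, ← div_eq_mul_inv, le_div_iff₀ (by positivity)]
  have h5 : Real.exp (-θ * n) * Real.exp (θ * (n + 1)) = Real.exp θ := by
    rw [← Real.exp_add]; congr 1; ring
  calc (n + 1) * Real.exp (-θ * n) * (n + 1) ^ 3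
      = 24 / θ ^ 4 * (Real.exp (-θ * n) * ((θ * (n + 1)) ^ 4 / 24)) := by field_simp
    _ ≤ 24 / θ ^ 4 * (Real.exp (-θ * n) * Real.exp (θ * (n + 1))) := by gcongr
    _ = _ := by rw [h5]

set_option maxHeartbeats 2000000 in
lemma volE (a b w c : ℝ) (ha : a ≠ 0) (hw3 : 3 ≤ w) (hw5 : w < 5) (hc0 : 0 < c) (hc1 : c ≤ 1)
    (hd : ∀ p : ℤ × ℤ, p ≠ 0 → ∀ z : ℤ,
      c * ((|p.1| + |p.2| : ℤ) : ℝ) ^ (-w) ≤ |(z : ℝ) + p.2 * b - p.1 * a|)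
    (B κ : ℝ) (hB : 0 ≤ B) (hκ0 : 0 < κ) (hκ : κ ≤ 1) :
    ∃ C : ℝ, 0 < C ∧ ∀ i j n m : ℕ, ∀ r : ℝ, m ≤ n → ((i = n ∧ j = m) ∨ (i = m ∧ j = n)) →
      r = 2 * ((n : ℝ) + 1) ^ (-κ) → 9 * ((1 + |a|) * r) ≤ 1 →
      volume {β : ℝ | |β| ≤ B ∧ ∃ p1 p2 q : ℤ, q ≠ 0 ∧ |(q : ℝ)| ≤ Real.exp (n + m + 2) * r ∧
        |(p1 : ℝ) + q * (a * β + b)| ≤ Real.exp (-i) * r ∧ |(p2 : ℝ) + q * β| ≤ Real.exp (-j) * r} ≤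
      ENNReal.ofReal (C * ((n : ℝ) + 1) ^ (-(3 * κ))) := by
  have ha0 := abs_pos.2 ha
  set G := 2 * (B + 1) with hG
  have hG0 : 0 < G := by positivity
  set D := 1 + |a| with hD
  set A := 1 + 1 / |a| with hA
  have hA0 : 0 < A := by positivity
  have hD0 : 0 < D := by positivity
  set P := 32 / c * G ^ w with hP
  have hP0 : 0 < P := by positivity
  obtain ⟨C2, θ, hC2, hθ, hθ1, ht2⟩ := term2 w P D hw3 hw5 hP0 hD0
  obtain ⟨C3, hC3, hpe⟩ := polyexp κ θ hκ hθ
  set C1 := 2916 * G ^ 2 * D * A with hC1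
  have hC10 : 0 < C1 := by positivity
  set C4 := 64 * A * C2 + 32 * A with hC4
  have hC40 : 0 < C4 := by positivity
  refine ⟨C1 * (16 * Real.exp 2) + 7 * C4 * C3, by positivity, ?_⟩
  intro i j n m r hmn hij hr hr9
  have hn0 : (0 : ℝ) ≤ n := by positivity
  have hm0 : (0 : ℝ) ≤ m := by positivity
  have hmn' : (m : ℝ) ≤ n := by exact_mod_cast hmn
  have hr0 : 0 < r := by rw [hr]; positivity
  have hr2 : r ≤ 2 := by
    rw [hr]
    have := Real.rpow_le_one_of_one_le_of_nonpos (x := (n : ℝ) + 1) (z := -κ) (by linarith) (by linarith)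
    linarith
  set μ := Real.exp (-n) * r with hμ
  set M := Real.exp (-m) * r with hM
  have hμ0 : 0 < μ := by positivity
  have hM0 : 0 < M := by positivity
  have hμM : μ ≤ M := by rw [hμ, hM]; gcongr
  have hMr : M ≤ r := by
    rw [hM]
    refine mul_le_of_le_one_left hr0.le ?_
    rw [Real.exp_le_one_iff]; linarith
  have hM9 : 9 * (D * M) ≤ 1 := by
    refine le_trans ?_ hr9
    gcongr
  have hρ : (Real.exp (-i) * r = μ ∧ Real.exp (-j) * r = M) ∨
      (Real.exp (-i) * r = M ∧ Real.exp (-j) * r = μ) := by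
    rcases hij with ⟨h1, h2⟩ | ⟨h1, h2⟩
    · left; rw [h1, h2]; exact ⟨rfl, rfl⟩
    · right; rw [h1, h2]; exact ⟨rfl, rfl⟩
  set Y := Real.exp (n + m + 2) * r with hY
  have hY0 : 0 < Y := by positivity
  by_cases hY1 : Y < 1
  · have : {β : ℝ | |β| ≤ B ∧ ∃ p1 p2 q : ℤ, q ≠ 0 ∧ |(q : ℝ)| ≤ Y ∧
        |(p1 : ℝ) + q * (a * β + b)| ≤ Real.exp (-i) * r ∧ |(p2 : ℝ) + q * β| ≤ Real.exp (-j) * r} = ∅ := by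
      ext β
      simp only [Set.mem_ofPred_eq, Set.mem_empty_iff_false, iff_false]
      rintro ⟨-, p1, p2, q, hq, hq1, -⟩
      have : |(q : ℝ)| < 1 := by linarith
      have h2 : |q| < 1 := by exact_mod_cast this
      exact hq (Int.abs_lt_one_iff.1 h2)
    rw [this, measure_empty]; exact zero_le
  push Not at hY1
  have hfl : ⌊Y⌋₊ ≠ 0 := by
    have : 1 ≤ ⌊Y⌋₊ := Nat.le_floor (by simpa using hY1)
    omega
  set K := Nat.log 2 ⌊Y⌋₊ with hK
  have hKY : (2 : ℝ) ^ K ≤ Y := by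
    have h1 : 2 ^ K ≤ ⌊Y⌋₊ := Nat.pow_log_le_self 2 hfl
    have h2 : ((2 ^ K : ℕ) : ℝ) ≤ (⌊Y⌋₊ : ℝ) := by exact_mod_cast h1
    push_cast at h2
    exact h2.trans (Nat.floor_le hY0.le)
  have hKn : (K : ℝ) + 1 ≤ 7 * (n + 1) := by
    have h1 := Real.log_le_log (by positivity) hKY
    rw [Real.log_pow, hY, Real.log_mul (by positivity) (by positivity), Real.log_exp] at h1
    have h2 : Real.log r ≤ Real.log 2 := Real.log_le_log hr0 hr2
    have h3 := Real.log_two_gt_d9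
    have h4 := Real.log_two_lt_d9
    have h5 : (0 : ℝ) ≤ K := by positivity
    nlinarith
  set E : ℕ → Set ℝ := fun k => {β : ℝ | |β| ≤ B ∧ ∃ p1 p2 q : ℤ, (2 : ℝ) ^ k ≤ |(q : ℝ)| ∧
      |(q : ℝ)| ≤ 2 * (2 : ℝ) ^ k ∧
      |(p1 : ℝ) + q * (a * β + b)| ≤ Real.exp (-i) * r ∧ |(p2 : ℝ) + q * β| ≤ Real.exp (-j) * r} with hE
  have hsub : {β : ℝ | |β| ≤ B ∧ ∃ p1 p2 q : ℤ, q ≠ 0 ∧ |(q : ℝ)| ≤ Y ∧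
        |(p1 : ℝ) + q * (a * β + b)| ≤ Real.exp (-i) * r ∧ |(p2 : ℝ) + q * β| ≤ Real.exp (-j) * r} ⊆
      ⋃ k ∈ Finset.range (K + 1), E k := by
    rintro β ⟨hβ, p1, p2, q, hq, hqY, h1, h2⟩
    rw [Set.mem_iUnion₂]
    have hqa : |(q : ℝ)| = (q.natAbs : ℝ) := by rw [Nat.cast_natAbs]; push_cast; rfl
    refine ⟨Nat.log 2 q.natAbs, ?_, hβ, p1, p2, q, ?_, ?_, h1, h2⟩
    · rw [Finset.mem_range, Nat.lt_succ_iff, hK]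
      apply Nat.log_mono_right
      apply Nat.le_floor
      rw [← hqa]; exact hqY
    · rw [hqa]
      exact_mod_cast Nat.pow_log_le_self 2 (Int.natAbs_ne_zero.2 hq)
    · rw [hqa]
      have := Nat.lt_pow_succ_log_self (b := 2) (by norm_num) q.natAbs
      have h3 : (q.natAbs : ℝ) < ((2 ^ (Nat.log 2 q.natAbs + 1) : ℕ) : ℝ) := by exact_mod_cast this
      push_cast at h3
      rw [pow_succ] at h3
      linarith
  have hEk : ∀ k ∈ Finset.range (K + 1), volume (E k) ≤
      ENNReal.ofReal (C1 * (M * μ) * 2 ^ k + C4 * Real.exp (-θ * n)) := by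
    intro k hk
    have hX1 : (1 : ℝ) ≤ 2 ^ k := one_le_pow₀ (by norm_num)
    have hXY : (2 : ℝ) ^ k ≤ Y := by
      refine le_trans ?_ hKY
      apply pow_le_pow_right₀ (by norm_num)
      rw [Finset.mem_range] at hk; omega
    refine (volEX a b w c ha hw3 hw5 hc0 hc1 hd B (2 ^ k) μ M _ _ hB hX1 hμ0 hμM hM9 hρ).trans ?_
    apply ENNReal.ofReal_le_ofReal
    rw [← hG, ← hD, ← hA]
    have t2 := ht2 n m r (2 ^ k) hm0 hmn' hr0 hr2 hX1 hXY
    set X : ℝ := 2 ^ k with hX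
    have hX0 : 0 < X := by linarith
    have eZ : 32 / c * ((G * X) ^ w * (D * M)) = P * (X ^ w * (D * (Real.exp (-m) * r))) := by
      rw [Real.mul_rpow hG0.le hX0.le, hP, hM]; ring
    rw [eZ]
    set V := (P * (X ^ w * (D * (Real.exp (-m) * r)))) ^ (2 / (w + 1)) with hV
    have t3 : μ / X ≤ 2 * Real.exp (-θ * n) := by
      calc μ / X ≤ μ := div_le_self hμ0.le hX1
        _ ≤ Real.exp (-θ * n) * 2 := by
          rw [hμ]; gcongr; nlinarith
        _ = _ := by ring
    have e : (1458 * (G * X) ^ 2 * (D * M) + 32 * V + 8) * (2 * (A * μ / X)) =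
        C1 * (M * μ) * X + 64 * A * (μ / X * V) + 16 * A * (μ / X) := by
      rw [hC1]; field_simp; ring
    rw [e, hC4]
    have t2' : 64 * A * (μ / X * V) ≤ 64 * A * (C2 * Real.exp (-θ * n)) := by gcongr
    have t3' : 16 * A * (μ / X) ≤ 16 * A * (2 * Real.exp (-θ * n)) := by gcongr
    linarith
  calc _ ≤ volume (⋃ k ∈ Finset.range (K + 1), E k) := measure_mono hsub
    _ ≤ ∑ k ∈ Finset.range (K + 1), volume (E k) := measure_biUnion_finset_le _ _
    _ ≤ ∑ k ∈ Finset.range (K + 1), ENNReal.ofReal (C1 * (M * μ) * 2 ^ k + C4 * Real.exp (-θ * n)) :=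
        Finset.sum_le_sum hEk
    _ = ENNReal.ofReal (∑ k ∈ Finset.range (K + 1), (C1 * (M * μ) * 2 ^ k + C4 * Real.exp (-θ * n))) := by
        rw [ENNReal.ofReal_sum_of_nonneg]
        intro k _; positivity
    _ ≤ _ := by
        apply ENNReal.ofReal_le_ofReal
        rw [Finset.sum_add_distrib, ← Finset.mul_sum, Finset.sum_const, Finset.card_range, nsmul_eq_mul]
        have hgeom : ∑ k ∈ Finset.range (K + 1), (2 : ℝ) ^ k ≤ 2 * Y := by
          rw [geom_sum_eq (by norm_num), pow_succ]
          linarith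
        have hMY : M * μ * (2 * Y) = 16 * Real.exp 2 * ((n : ℝ) + 1) ^ (-(3 * κ)) := by
          have : M * μ * (2 * Y) = 2 * r ^ 3 * (Real.exp (-m) * Real.exp (-n) * Real.exp (n + m + 2)) := by
            rw [hM, hμ, hY]; ring
          rw [this, ← Real.exp_add, ← Real.exp_add, hr, mul_pow, ← Real.rpow_natCast, ← Real.rpow_natCast,
            ← Real.rpow_mul (by positivity)]
          have e1 : -(m : ℝ) + -n + (n + m + 2) = 2 := by ring
          have e2 : -κ * ((3 : ℕ) : ℝ) = -(3 * κ) := by push_cast; ring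
          rw [e1, e2]
          norm_num
          ring
        have h1 : C1 * (M * μ) * ∑ k ∈ Finset.range (K + 1), (2 : ℝ) ^ k ≤
            C1 * (16 * Real.exp 2 * ((n : ℝ) + 1) ^ (-(3 * κ))) := by
          rw [← hMY, mul_assoc]
          gcongr
        have h2 : ((K + 1 : ℕ) : ℝ) * (C4 * Real.exp (-θ * n)) ≤ 7 * C4 * C3 * ((n : ℝ) + 1) ^ (-(3 * κ)) := by
          push_cast
          calc ((K : ℝ) + 1) * (C4 * Real.exp (-θ * n)) ≤ 7 * (n + 1) * (C4 * Real.exp (-θ * n)) := by gcongr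
            _ = 7 * C4 * ((n + 1) * Real.exp (-θ * n)) := by ring
            _ ≤ 7 * C4 * (C3 * ((n : ℝ) + 1) ^ (-(3 * κ))) := by
              exact mul_le_mul_of_nonneg_left (hpe n hn0) (by positivity)
            _ = _ := by ring
        linarith

lemma sum_max (σ : ℝ) (hσ : 2 < σ) (C : ℝ) (hC : 0 < C) :
    ∑' p : ℕ × ℕ, ENNReal.ofReal (C * (((max p.1 p.2 : ℕ) : ℝ) + 1) ^ (-σ)) ≠ ⊤ := by
  have h1 : Summable (fun n : ℕ => ((n : ℝ) + 1) ^ (-(σ / 2))) := by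
    have := (summable_nat_add_iff 1).2 (Real.summable_nat_rpow (p := -(σ / 2)) |>.2 (by linarith))
    simpa using this
  have h2 : Summable (fun p : ℕ × ℕ => ((p.1 : ℝ) + 1) ^ (-(σ / 2)) * ((p.2 : ℝ) + 1) ^ (-(σ / 2))) :=
    h1.mul_of_nonneg h1 (fun n => by positivity) (fun n => by positivity)
  have h3 : Summable (fun p : ℕ × ℕ => C * (((max p.1 p.2 : ℕ) : ℝ) + 1) ^ (-σ)) := by
    refine Summable.of_nonneg_of_le (fun p => by positivity) (fun p => ?_) (h2.mul_left C)
    gcongr 1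
    have e : (((max p.1 p.2 : ℕ) : ℝ) + 1) ^ (-σ) =
        (((max p.1 p.2 : ℕ) : ℝ) + 1) ^ (-(σ / 2)) * (((max p.1 p.2 : ℕ) : ℝ) + 1) ^ (-(σ / 2)) := by
      rw [← Real.rpow_add (by positivity)]; congr 1; ring
    rw [e]
    have m1 : (p.1 : ℝ) ≤ ((max p.1 p.2 : ℕ) : ℝ) := by exact_mod_cast le_max_left _ _
    have m2 : (p.2 : ℝ) ≤ ((max p.1 p.2 : ℕ) : ℝ) := by exact_mod_cast le_max_right _ _
    apply mul_le_mul
    · exact Real.rpow_le_rpow_of_nonpos (by positivity) (by linarith) (by linarith)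
    · exact Real.rpow_le_rpow_of_nonpos (by positivity) (by linarith) (by linarith)
    · positivity
    · positivity
  exact h3.tsum_ofReal_ne_top

lemma comps (t s y x : ℝ) (v : Fin 3 → ℝ) :
    (aM t s * uM y x).mulVec v = ![Real.exp t * (v 0 + v 2 * y), Real.exp s * (v 1 + v 2 * x),
      Real.exp (-t - s) * v 2] := by
  ext i
  fin_cases i <;>
    simp [aM, uM, Matrix.mulVec, dotProduct, Fin.sum_univ_three, Matrix.mul_apply] <;> ring

lemma detail (a b β κ r t s : ℝ) (i j n m : ℕ) (hκ : 0 < κ) (hκ1 : κ ≤ 1) (ht : 0 ≤ t) (hs : 0 ≤ s)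
    (hi : i = ⌊t⌋₊) (hj : j = ⌊s⌋₊) (hn : n = max i j) (hm : m = min i j) (hn1 : 1 ≤ n)
    (hr : r = 2 * ((n : ℝ) + 1) ^ (-κ)) (hr1 : r < 1)
    (hno : ¬ ∃ p1 p2 q : ℤ, q ≠ 0 ∧ |(q : ℝ)| ≤ Real.exp (n + m + 2) * r ∧
        |(p1 : ℝ) + q * (a * β + b)| ≤ Real.exp (-i) * r ∧ |(p2 : ℝ) + q * β| ≤ Real.exp (-j) * r) :
    latDelta (aM t s * uM (a * β + b) β) ≤ κ * Real.log (max t s) := by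
  have hit : (i : ℝ) ≤ t := by rw [hi]; exact Nat.floor_le ht
  have hjs : (j : ℝ) ≤ s := by rw [hj]; exact Nat.floor_le hs
  have hti : t < i + 1 := by rw [hi]; exact Nat.lt_floor_add_one t
  have hsj : s < j + 1 := by rw [hj]; exact Nat.lt_floor_add_one s
  have hnm : (n : ℝ) + m = i + j := by
    rw [hn, hm]; exact_mod_cast max_add_min i j
  have hn1' : (1 : ℝ) ≤ n := by exact_mod_cast hn1
  have hnmx : (n : ℝ) ≤ max t s := by
    rw [hn]; push_cast; exact max_le_max hit hjs
  set mx := max t s with hmx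
  have hmx1 : 1 ≤ mx := by linarith
  have hL : 0 ≤ Real.log mx := Real.log_nonneg hmx1
  have hr0 : 0 < r := by rw [hr]; positivity
  have hρr : mx ^ (-κ) ≤ r := by
    calc mx ^ (-κ) ≤ (((n : ℝ) + 1) / 2) ^ (-κ) :=
          Real.rpow_le_rpow_of_nonpos (by positivity) (by linarith) (by linarith)
      _ = ((n : ℝ) + 1) ^ (-κ) * 2 ^ κ := by
          rw [Real.div_rpow (by positivity) (by norm_num), Real.rpow_neg (x := 2) (by norm_num)]
          field_simp
      _ ≤ ((n : ℝ) + 1) ^ (-κ) * 2 ^ (1 : ℝ) := by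
          gcongr
          norm_num
      _ = r := by rw [hr, Real.rpow_one]; ring
  apply Real.iSup_le _ (by positivity)
  rintro ⟨v, hv⟩
  by_contra hcon
  push Not at hcon
  simp only [comps] at hcon
  set u : Fin 3 → ℝ := ![Real.exp t * ((v 0 : ℝ) + v 2 * (a * β + b)), Real.exp s * ((v 1 : ℝ) + v 2 * β),
      Real.exp (-t - s) * v 2] with hu
  have hun : ‖u‖ ≤ r := by
    refine le_trans ?_ hρr
    have hu0 : 0 < ‖u‖ := by
      rcases (norm_nonneg u).eq_or_lt with h | h
      · rw [← h] at hcon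
        simp at hcon
        have : 0 ≤ κ * Real.log mx := by positivity
        linarith
      · exact h
    rw [one_div, Real.log_inv] at hcon
    rw [← Real.log_le_log_iff hu0 (by positivity), Real.log_rpow (by linarith)]
    linarith
  rw [pi_norm_le_iff_of_nonneg hr0.le, Fin.forall_fin_succ, Fin.forall_fin_succ, Fin.forall_fin_succ] at hun
  simp [hu] at hun
  obtain ⟨u1, u2, u3⟩ := hun
  have k1 : |(v 0 : ℝ) + v 2 * (a * β + b)| ≤ Real.exp (-i) * r := by
    calc _ = Real.exp (-t) * (Real.exp t * |(v 0 : ℝ) + v 2 * (a * β + b)|) := by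
          rw [← mul_assoc, ← Real.exp_add]; simp
      _ ≤ Real.exp (-i) * r := by gcongr
  have k2 : |(v 1 : ℝ) + v 2 * β| ≤ Real.exp (-j) * r := by
    calc _ = Real.exp (-s) * (Real.exp s * |(v 1 : ℝ) + v 2 * β|) := by
          rw [← mul_assoc, ← Real.exp_add]; simp
      _ ≤ Real.exp (-j) * r := by gcongr
  have k3 : |(v 2 : ℝ)| ≤ Real.exp (n + m + 2) * r := by
    calc _ = Real.exp (t + s) * (Real.exp (-t - s) * |(v 2 : ℝ)|) := by
          rw [← mul_assoc, ← Real.exp_add]; simp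
      _ ≤ Real.exp (n + m + 2) * r := by
          have hexp : Real.exp (t + s) ≤ Real.exp (n + m + 2) := Real.exp_le_exp.2 (by linarith)
          exact mul_le_mul hexp u3 (by positivity) (by positivity)
  have small : ∀ (z : ℤ) (l : ℕ), |(z : ℝ)| ≤ Real.exp (-l) * r → z = 0 := by
    intro z l h
    have h1 : Real.exp (-(l : ℝ)) ≤ 1 := by rw [Real.exp_le_one_iff]; simp
    have h2 : |(z : ℝ)| < 1 := by nlinarith
    have h3 : |z| < 1 := by exact_mod_cast h2
    exact Int.abs_lt_one_iff.1 h3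
  by_cases hq : v 2 = 0
  · rw [hq] at k1 k2
    apply hv
    ext l
    fin_cases l
    · exact small _ i (by simpa using k1)
    · exact small _ j (by simpa using k2)
    · exact hq
  · exact hno ⟨v 0, v 1, v 2, hq, k3, k1, k2⟩

/-- **Logarithm law, upper bound** (from Chow–Yang, Corollary 1.8). -/
theorem log_law_upper_bound (a b : ℝ) (hab : DualExpLtFive a b)
    (κ : ℝ) (hκ : 2 / 3 < κ) :
    ∀ᵐ β ∂(volume : Measure ℝ),
      ∀ ε : ℝ, 0 < ε → ∃ T : ℝ, ∀ t s : ℝ, 0 ≤ t → 0 ≤ s → T ≤ max t s →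
        latDelta (aM t s * uM (a * β + b) β) ≤ (κ + ε) * Real.log (max t s) := by
  obtain ⟨w, c, hw3, hw5, hc0, hc1, hd⟩ := dioph a b hab
  have ha : a ≠ 0 := by
    rintro rfl
    have := hd (1, 0) (by simp) 0
    simp at this
    linarith
  set k := min κ 1 with hk
  have hk1 : k ≤ 1 := min_le_right _ _
  have hkκ : k ≤ κ := min_le_left _ _
  have hk23 : 2 / 3 < k := lt_min hκ (by norm_num)
  set r : ℕ → ℝ := fun n => 2 * ((n : ℝ) + 1) ^ (-k) with hr
  obtain ⟨N1, hN1⟩ : ∃ N1 : ℕ, ∀ n ≥ N1, 9 * ((1 + |a|) * r n) ≤ 1 := by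
    have h1 : Filter.Tendsto (fun n : ℕ => ((n : ℝ) + 1) ^ (-k)) Filter.atTop (nhds 0) :=
      (tendsto_rpow_neg_atTop (by linarith)).comp
        (Filter.tendsto_atTop_add_const_right _ _ tendsto_natCast_atTop_atTop)
    have h2 : Filter.Tendsto (fun n : ℕ => 9 * ((1 + |a|) * r n)) Filter.atTop (nhds 0) := by
      have := h1.const_mul (9 * ((1 + |a|) * 2))
      rw [mul_zero] at this
      refine this.congr fun n => ?_
      simp only [hr]; ring
    exact Filter.eventually_atTop.1 (h2.eventually_le_const one_pos)
  set E : ℕ → ℕ × ℕ → Set ℝ := fun B p => {β : ℝ | N1 ≤ max p.1 p.2 ∧ (|β| ≤ B ∧ ∃ p1 p2 q : ℤ, q ≠ 0 ∧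
        |(q : ℝ)| ≤ Real.exp (((max p.1 p.2 : ℕ) : ℝ) + ((min p.1 p.2 : ℕ) : ℝ) + 2) * r (max p.1 p.2) ∧
        |(p1 : ℝ) + q * (a * β + b)| ≤ Real.exp (-(p.1 : ℝ)) * r (max p.1 p.2) ∧
        |(p2 : ℝ) + q * β| ≤ Real.exp (-(p.2 : ℝ)) * r (max p.1 p.2))} with hE
  have hae : ∀ B : ℕ, ∀ᵐ β ∂(volume : Measure ℝ), {p | β ∈ E B p}.Finite := by
    intro B
    obtain ⟨C, hC, hvol⟩ := volE a b w c ha hw3 hw5 hc0 hc1 hd B k (by positivity) (by linarith) hk1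
    apply ae_finite_setOfPred_mem
    refine ne_top_of_le_ne_top (sum_max (3 * k) (by linarith) C hC) (ENNReal.tsum_le_tsum fun p => ?_)
    by_cases hp : N1 ≤ max p.1 p.2
    · refine (measure_mono fun β hβ => hβ.2).trans (hvol p.1 p.2 (max p.1 p.2) (min p.1 p.2) (r (max p.1 p.2))
        min_le_max ?_ rfl (hN1 _ hp))
      rcases le_total p.1 p.2 with h | h
      · right; simp [h]
      · left; simp [h]
    · have : E B p = ∅ := by
        ext β
        simp only [Set.mem_empty_iff_false, iff_false]
        intro h; exact hp h.1
      rw [this, measure_empty]; exact zero_le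
  filter_upwards [ae_all_iff.2 hae] with β hβ ε hε
  obtain ⟨B, hB⟩ := exists_nat_ge |β|
  obtain ⟨N0, hN0⟩ := ((hβ B).image fun p => max p.1 p.2).bddAbove
  refine ⟨N0 + N1 + 2, fun t s ht hs hT => ?_⟩
  set n := max ⌊t⌋₊ ⌊s⌋₊ with hn
  have hmx : max t s < n + 1 := by
    rw [hn]; push_cast
    rw [max_lt_iff]
    constructor
    · linarith [Nat.lt_floor_add_one t, le_max_left (⌊t⌋₊ : ℝ) (⌊s⌋₊ : ℝ)]
    · linarith [Nat.lt_floor_add_one s, le_max_right (⌊t⌋₊ : ℝ) (⌊s⌋₊ : ℝ)]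
  have hnN : N0 + N1 + 1 < n := by
    have : (N0 : ℝ) + N1 + 1 < n := by linarith
    exact_mod_cast this
  have hr9 := hN1 n (by omega)
  have hr0 : 0 < r n := by simp only [hr]; positivity
  have hr1 : r n < 1 := by nlinarith [abs_nonneg a, mul_nonneg (abs_nonneg a) hr0.le]
  have hno : β ∉ E B (⌊t⌋₊, ⌊s⌋₊) := by
    intro h
    have h1 : n ≤ N0 := hN0 ⟨(⌊t⌋₊, ⌊s⌋₊), h, rfl⟩
    omega
  have hmain := detail a b β k (r n) t s ⌊t⌋₊ ⌊s⌋₊ n (min ⌊t⌋₊ ⌊s⌋₊) (by linarith) hk1 ht hs rfl rfl hn rfl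
    (by omega) rfl hr1 (fun hex => hno ⟨by simp only; omega, hB, hex⟩)
  refine hmain.trans ?_
  have hL : 0 ≤ Real.log (max t s) := Real.log_nonneg (by
    have h1 : (0 : ℝ) ≤ N0 := by positivity
    have h2 : (0 : ℝ) ≤ N1 := by positivity
    linarith)
  gcongr
  linarith

end
end
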